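/- arXiv:1601.07541 — 2 statements merged into one kernel-verified Lean document; each statement's English description precedes it below -/
import Mathlib

section
/- Let p be a prime and k a positive integer. There exists an AP-destroying permutation of the elementary p-group (ℤ/pℤ)^k if and only if p is odd and (p,k) ∉ {(3,1),(5,1),(7,1)}. -/
/-- There is an AP-destroying permutation, in centred form. -/
def HasAPD (G : Type) [AddCommGroup G] : Prop :=
  ∃ f : G → G, Function.Injective f ∧ ∀ x d : G, d ≠ 0 → f (x - d) + f (x + d) ≠ f x + f x

theorem hasAPD_iff (G : Type) [AddCommGroup G] [Finite G] :
    HasAPD G ↔ ∃ π : Equiv.Perm G, ∀ a b c : G, b - a = c - b → b - a ≠ 0 →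
          π b - π a ≠ π c - π b := by
  constructor
  · rintro ⟨f, hf, h⟩
    refine ⟨Equiv.ofBijective f (Finite.injective_iff_bijective.mp hf), ?_⟩
    intro a b c h1 h2 h3
    simp only [Equiv.ofBijective_apply] at h3
    apply h b (b - a) h2
    rw [show b - (b - a) = a by abel, h1, show b + (c - b) = c by abel]
    have := sub_eq_sub_iff_add_eq_add.mp h3
    rw [this]; abel
  · rintro ⟨π, h⟩
    refine ⟨π, π.injective, ?_⟩
    intro x d hd h1
    apply h (x - d) x (x + d) (by abel) (by simpa using hd)
    rw [sub_eq_sub_iff_add_eq_add, ← h1]; abel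

theorem HasAPD.of_equiv {G H : Type} [AddCommGroup G] [AddCommGroup H] (e : G ≃+ H)
    (h : HasAPD H) : HasAPD G := by
  obtain ⟨f, hf, h⟩ := h
  refine ⟨fun x => e.symm (f (e x)), ?_, ?_⟩
  · intro x y hxy
    exact e.injective (hf (e.symm.injective hxy))
  · intro x d hd h1
    apply h (e x) (e d) (by simpa using hd)
    have := congrArg e h1
    simpa using this

theorem HasAPD.prod {G H : Type} [AddCommGroup G] [AddCommGroup H]
    (hG : HasAPD G) (hH : HasAPD H) : HasAPD (G × H) := by
  obtain ⟨f, hf, h⟩ := hG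
  obtain ⟨g, hg, h'⟩ := hH
  refine ⟨Prod.map f g, hf.prodMap hg, ?_⟩
  rintro ⟨x, y⟩ ⟨d, e⟩ hd h1
  simp only [Prod.map, Prod.mk_sub_mk, Prod.mk_add_mk, Prod.mk.injEq] at h1
  by_cases hd0 : d = 0
  · by_cases he0 : e = 0
    · subst hd0 he0; exact hd rfl
    · exact h' y e he0 h1.2
  · exact h x d hd0 h1.1

section small
variable {F : Type} [Field F]

theorem hasAPD_two (h2 : (2 : F) ≠ 0) : HasAPD (Fin 2 → F) := by
  refine ⟨fun v => ![v 0 + v 1 ^ 2, v 1 + (v 0 + v 1 ^ 2) ^ 2], ?_, ?_⟩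
  · intro v w h
    have h0 := congrFun h 0
    have h1 := congrFun h 1
    simp at h0 h1
    rw [h0] at h1
    have h3 : v 1 = w 1 := by simpa using h1
    rw [h3] at h0
    ext i; fin_cases i
    · simpa using h0
    · exact h3
  · intro x d hd h
    have h0 := congrFun h 0
    have h1 := congrFun h 1
    simp at h0 h1
    have e1 : 2 * d 1 ^ 2 = 0 := by linear_combination h0
    have e2 : d 1 = 0 := by simpa [h2] using e1
    rw [e2] at h1
    have e3 : 2 * d 0 ^ 2 = 0 := by linear_combination h1
    have e4 : d 0 = 0 := by simpa [h2] using e3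
    apply hd; ext i; fin_cases i
    · exact e4
    · exact e2

theorem hasAPD_three (h2 : (2 : F) ≠ 0) (n : F) (hn : ¬ IsSquare n) : HasAPD (Fin 3 → F) := by
  refine ⟨fun v => ![v 0 + (v 1 ^ 2 - n * v 2 ^ 2),
    v 1 + (v 0 + (v 1 ^ 2 - n * v 2 ^ 2)) ^ 2, v 2], ?_, ?_⟩
  · intro v w h
    have h0 := congrFun h 0
    have h1 := congrFun h 1
    have h2 := congrFun h 2
    simp at h0 h1 h2
    rw [h0] at h1
    have h3 : v 1 = w 1 := by simpa using h1
    rw [h3, h2] at h0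
    ext i; fin_cases i
    · simpa using h0
    · exact h3
    · exact h2
  · intro x d hd h
    have h0 := congrFun h 0
    have h1 := congrFun h 1
    simp at h0 h1
    have e1 : 2 * (d 1 ^ 2 - n * d 2 ^ 2) = 0 := by linear_combination h0
    have e2 : d 1 ^ 2 - n * d 2 ^ 2 = 0 := by simpa [h2] using e1
    have e3 : d 2 = 0 := by
      by_contra h3
      apply hn
      refine ⟨d 1 / d 2, ?_⟩
      field_simp
      linear_combination -e2
    have e4 : d 1 = 0 := by simpa [e3] using e2
    rw [e3, e4] at h1
    have e5 : 2 * d 0 ^ 2 = 0 := by linear_combination h1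
    have e6 : d 0 = 0 := by simpa [h2] using e5
    apply hd; ext i; fin_cases i
    · exact e6
    · exact e4
    · exact e3

end small

theorem hasAPD_add (F : Type) [Field F] (m n : ℕ) (hm : HasAPD (Fin m → F))
    (hn : HasAPD (Fin n → F)) : HasAPD (Fin (m + n) → F) := by
  refine HasAPD.of_equiv ?_ (hm.prod hn)
  exact ((LinearEquiv.funCongrLeft F F finSumFinEquiv).trans
    (LinearEquiv.sumArrowLequivProdArrow (Fin m) (Fin n) F F)).toAddEquiv

theorem hasAPD_ge_two (F : Type) [Field F] [Finite F] (h2 : (2 : F) ≠ 0) (k : ℕ) (hk : 2 ≤ k) :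
    HasAPD (Fin k → F) := by
  have hch : ringChar F ≠ 2 := by
    intro h
    apply h2
    have := ringChar.Nat.cast_ringChar (R := F)
    rw [h] at this
    exact_mod_cast this
  obtain ⟨n, hn⟩ := FiniteField.exists_nonsquare hch
  induction k using Nat.strong_induction_on with
  | _ k ih =>
    rcases Nat.lt_or_ge k 4 with h | h
    · interval_cases k
      · exact hasAPD_two h2
      · exact hasAPD_three h2 n hn
    · obtain ⟨m, rfl⟩ : ∃ m, k = m + 2 := ⟨k - 2, by omega⟩
      exact hasAPD_add F m 2 (ih m (by omega) (by omega)) (hasAPD_two h2)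

theorem hasAPD_one_iff (p : ℕ) : HasAPD (Fin 1 → ZMod p) ↔ HasAPD (ZMod p) := by
  have e : (Fin 1 → ZMod p) ≃+ ZMod p := (LinearEquiv.funUnique (Fin 1) (ZMod p) (ZMod p)).toAddEquiv
  exact ⟨HasAPD.of_equiv e.symm, HasAPD.of_equiv e⟩

theorem not_hasAPD_two (k : ℕ) (hk : 0 < k) : ¬ HasAPD (Fin k → ZMod 2) := by
  rintro ⟨f, -, h⟩
  have key : ∀ v : Fin k → ZMod 2, v + v = 0 := fun v => by
    ext i; exact CharTwo.add_self_eq_zero (v i)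
  apply h 0 (fun _ => 1)
  · intro h0
    have := congrFun h0 ⟨0, hk⟩
    simp at this
  · rw [key, sub_eq_add_neg, neg_eq_of_add_eq_zero_left (key _)]
    exact key _

theorem not_hasAPD_z3 : ¬ HasAPD (ZMod 3) := by
  rintro ⟨f, hf, h⟩
  have key : ∀ a b c : ZMod 3, b ≠ a → c ≠ a → c ≠ b → a + c = b + b := by decide
  have := h 1 1 (by decide)
  simp only [show (1 - 1 : ZMod 3) = 0 by decide, show (1 + 1 : ZMod 3) = 2 by decide] at this
  exact this (key _ _ _ (hf.ne (by decide)) (hf.ne (by decide)) (hf.ne (by decide)))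

theorem HasAPD.normalize {F : Type} [Field F] (h : HasAPD F) :
    ∃ f : F → F, Function.Injective f ∧ f 0 = 0 ∧ f 1 = 1 ∧
      ∀ x y z : F, x + z = y + y → y ≠ x → f x + f z ≠ f y + f y := by
  obtain ⟨f, hf, h⟩ := h
  have h01 : f 1 - f 0 ≠ 0 := sub_ne_zero.mpr (hf.ne one_ne_zero)
  refine ⟨fun x => (f x - f 0) / (f 1 - f 0), ?_, by simp, by simp [h01], ?_⟩
  · intro x y hxy
    simp only at hxy
    rw [div_left_inj' h01] at hxy
    exact hf (by linear_combination hxy)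
  · intro x y z h1 h2 h3
    have := h y (y - x) (sub_ne_zero.mpr h2)
    rw [show y - (y - x) = x by ring, show y + (y - x) = z by linear_combination -h1] at this
    apply this
    field_simp at h3
    linear_combination h3

theorem HasAPD.normalize_zmod (p : ℕ) (hp : p.Prime) (h : HasAPD (ZMod p)) :
    ∃ f : ZMod p → ZMod p, Function.Injective f ∧ f 0 = 0 ∧ f 1 = 1 ∧
      ∀ x y z : ZMod p, x + z = y + y → y ≠ x → f x + f z ≠ f y + f y := by
  have : Fact p.Prime := ⟨hp⟩
  exact HasAPD.normalize h

set_option synthInstance.maxHeartbeats 400000 in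
set_option synthInstance.maxSize 4000 in
theorem not_hasAPD_z5 : ¬ HasAPD (ZMod 5) := by
  intro H
  obtain ⟨f, hf, h0, h1, h⟩ := HasAPD.normalize_zmod _ (by norm_num) H
  have key : ∀ c : ZMod 5, (c ≠ 0 ∧ c ≠ 1 ∧ 0 + c ≠ 1 + 1) →
      ∀ d : ZMod 5, (d ≠ 0 ∧ d ≠ 1 ∧ d ≠ c ∧ d + c ≠ 0 + 0 ∧ 1 + d ≠ c + c ∧ 1 + 0 ≠ d + d) →
      ∀ e : ZMod 5, (e ≠ 0 ∧ e ≠ 1 ∧ e ≠ c ∧ e ≠ d ∧ e + 1 ≠ 0 + 0 ∧ e + d ≠ 1 + 1 ∧ 0 + e ≠ c + c ∧ c + e ≠ d + d ∧ d + 0 ≠ e + e ∧ c + 1 ≠ e + e) →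
      False := by decide +kernel
  have N : ∀ x y : ZMod 5, x ≠ y → f x ≠ f y := fun x y hxy => hf.ne hxy
  exact key (f 2)
    ⟨by simpa only [h0, h1] using N 2 0 (by decide),
     by simpa only [h0, h1] using N 2 1 (by decide),
     by simpa only [h0, h1] using h 0 1 2 (by decide) (by decide)⟩ (f 3)
    ⟨by simpa only [h0, h1] using N 3 0 (by decide),
     by simpa only [h0, h1] using N 3 1 (by decide),
     by simpa only [h0, h1] using N 3 2 (by decide),
     by simpa only [h0, h1] using h 3 0 2 (by decide) (by decide),
     by simpa only [h0, h1] using h 1 2 3 (by decide) (by decide),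
     by simpa only [h0, h1] using h 1 3 0 (by decide) (by decide)⟩ (f 4)
    ⟨by simpa only [h0, h1] using N 4 0 (by decide),
     by simpa only [h0, h1] using N 4 1 (by decide),
     by simpa only [h0, h1] using N 4 2 (by decide),
     by simpa only [h0, h1] using N 4 3 (by decide),
     by simpa only [h0, h1] using h 4 0 1 (by decide) (by decide),
     by simpa only [h0, h1] using h 4 1 3 (by decide) (by decide),
     by simpa only [h0, h1] using h 0 2 4 (by decide) (by decide),
     by simpa only [h0, h1] using h 2 3 4 (by decide) (by decide),
     by simpa only [h0, h1] using h 3 4 0 (by decide) (by decide),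
     by simpa only [h0, h1] using h 2 4 1 (by decide) (by decide)⟩

set_option synthInstance.maxHeartbeats 400000 in
set_option synthInstance.maxSize 4000 in
theorem not_hasAPD_z7 : ¬ HasAPD (ZMod 7) := by
  intro H
  obtain ⟨f, hf, h0, h1, h⟩ := HasAPD.normalize_zmod _ (by norm_num) H
  have key : ∀ c : ZMod 7, (c ≠ 0 ∧ c ≠ 1 ∧ 0 + c ≠ 1 + 1) →
      ∀ d : ZMod 7, (d ≠ 0 ∧ d ≠ 1 ∧ d ≠ c ∧ 1 + d ≠ c + c) →
      ∀ e : ZMod 7, (e ≠ 0 ∧ e ≠ 1 ∧ e ≠ c ∧ e ≠ d ∧ e + d ≠ 0 + 0 ∧ 0 + e ≠ c + c ∧ c + e ≠ d + d ∧ 1 + 0 ≠ e + e) →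
      ∀ g : ZMod 7, (g ≠ 0 ∧ g ≠ 1 ∧ g ≠ c ∧ g ≠ d ∧ g ≠ e ∧ g + c ≠ 0 + 0 ∧ g + e ≠ 1 + 1 ∧ 1 + g ≠ d + d ∧ d + g ≠ e + e ∧ d + 0 ≠ g + g ∧ c + 1 ≠ g + g) →
      ∀ h : ZMod 7, (h ≠ 0 ∧ h ≠ 1 ∧ h ≠ c ∧ h ≠ d ∧ h ≠ e ∧ h ≠ g ∧ h + 1 ≠ 0 + 0 ∧ h + d ≠ 1 + 1 ∧ h + g ≠ c + c ∧ 0 + h ≠ d + d ∧ c + h ≠ e + e ∧ e + h ≠ g + g ∧ g + 0 ≠ h + h ∧ e + 1 ≠ h + h ∧ d + c ≠ h + h) →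
      False := by decide +kernel
  have N : ∀ x y : ZMod 7, x ≠ y → f x ≠ f y := fun x y hxy => hf.ne hxy
  exact key (f 2)
    ⟨by simpa only [h0, h1] using N 2 0 (by decide),
     by simpa only [h0, h1] using N 2 1 (by decide),
     by simpa only [h0, h1] using h 0 1 2 (by decide) (by decide)⟩ (f 3)
    ⟨by simpa only [h0, h1] using N 3 0 (by decide),
     by simpa only [h0, h1] using N 3 1 (by decide),
     by simpa only [h0, h1] using N 3 2 (by decide),
     by simpa only [h0, h1] using h 1 2 3 (by decide) (by decide)⟩ (f 4)
    ⟨by simpa only [h0, h1] using N 4 0 (by decide),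
     by simpa only [h0, h1] using N 4 1 (by decide),
     by simpa only [h0, h1] using N 4 2 (by decide),
     by simpa only [h0, h1] using N 4 3 (by decide),
     by simpa only [h0, h1] using h 4 0 3 (by decide) (by decide),
     by simpa only [h0, h1] using h 0 2 4 (by decide) (by decide),
     by simpa only [h0, h1] using h 2 3 4 (by decide) (by decide),
     by simpa only [h0, h1] using h 1 4 0 (by decide) (by decide)⟩ (f 5)
    ⟨by simpa only [h0, h1] using N 5 0 (by decide),
     by simpa only [h0, h1] using N 5 1 (by decide),
     by simpa only [h0, h1] using N 5 2 (by decide),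
     by simpa only [h0, h1] using N 5 3 (by decide),
     by simpa only [h0, h1] using N 5 4 (by decide),
     by simpa only [h0, h1] using h 5 0 2 (by decide) (by decide),
     by simpa only [h0, h1] using h 5 1 4 (by decide) (by decide),
     by simpa only [h0, h1] using h 1 3 5 (by decide) (by decide),
     by simpa only [h0, h1] using h 3 4 5 (by decide) (by decide),
     by simpa only [h0, h1] using h 3 5 0 (by decide) (by decide),
     by simpa only [h0, h1] using h 2 5 1 (by decide) (by decide)⟩ (f 6)
    ⟨by simpa only [h0, h1] using N 6 0 (by decide),
     by simpa only [h0, h1] using N 6 1 (by decide),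
     by simpa only [h0, h1] using N 6 2 (by decide),
     by simpa only [h0, h1] using N 6 3 (by decide),
     by simpa only [h0, h1] using N 6 4 (by decide),
     by simpa only [h0, h1] using N 6 5 (by decide),
     by simpa only [h0, h1] using h 6 0 1 (by decide) (by decide),
     by simpa only [h0, h1] using h 6 1 3 (by decide) (by decide),
     by simpa only [h0, h1] using h 6 2 5 (by decide) (by decide),
     by simpa only [h0, h1] using h 0 3 6 (by decide) (by decide),
     by simpa only [h0, h1] using h 2 4 6 (by decide) (by decide),
     by simpa only [h0, h1] using h 4 5 6 (by decide) (by decide),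
     by simpa only [h0, h1] using h 5 6 0 (by decide) (by decide),
     by simpa only [h0, h1] using h 4 6 1 (by decide) (by decide),
     by simpa only [h0, h1] using h 3 6 2 (by decide) (by decide)⟩

namespace APD
variable {F : Type} [Field F]

/-- The four exceptional points of the graph. -/
def IsE (t x y : F) : Prop :=
  (x = 0 ∧ y = 3 * t) ∨ (x = 1 ∧ y = 3) ∨ (x = t ∧ y = t) ∨ (x = 3 ∧ y = 0)

/-- The points of the hyperbola `x y = 3 t` that are kept. -/
def IsH (t x y : F) : Prop := x ≠ 0 ∧ x ≠ 1 ∧ x ≠ t ∧ x ≠ 3 ∧ x * y = 3 * t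

/-- The nondegeneracy conditions on the parameter. -/
structure Nondeg (t : F) : Prop where
  c2 : (2 : F) ≠ 0
  c3 : (3 : F) ≠ 0
  c5 : (5 : F) ≠ 0
  c7 : (7 : F) ≠ 0
  t0 : t ≠ 0
  t1 : t - 1 ≠ 0
  t3 : t - 3 ≠ 0
  t9 : t - 9 ≠ 0
  a1 : 3 * t - 1 ≠ 0
  a2 : 5 * t + 3 ≠ 0
  a3 : 3 * t - 4 ≠ 0
  a4 : t + 2 ≠ 0
  a5 : 2 * t + 3 ≠ 0
  a6 : 4 * t - 9 ≠ 0
  a7 : t + 5 ≠ 0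
  q1 : t ^ 2 - 11 * t + 12 ≠ 0
  q2 : 4 * t ^ 2 - 11 * t + 3 ≠ 0
  q3 : t ^ 2 - 8 * t + 3 ≠ 0

variable {t : F}

theorem core1 (h : Nondeg t) {a b c y z w : F} (hb : IsE t b z) (ha : IsE t a y) (hc : IsH t c w)
    (h1 : a + c = b + b) (h2 : y + w = z + z) (hab : a ≠ b) : False := by
  obtain ⟨-, -, -, -, hk⟩ := hc
  have e1 : c = b + b - a := by linear_combination h1
  have e2 : w = z + z - y := by linear_combination h2
  have c3 := h.c3
  have c5 := h.c5
  have c7 := h.c7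
  have t0 := h.t0
  have m1 : (3 : F) * (3 * t - 1) ≠ 0 := mul_ne_zero c3 h.a1
  have m2 : t * (5 * t + 3) ≠ 0 := mul_ne_zero t0 h.a2
  have m3 : t * (3 * 7) ≠ 0 := mul_ne_zero t0 (mul_ne_zero c3 c7)
  have m4 : (3 : F) * (3 * t - 4) ≠ 0 := mul_ne_zero c3 h.a3
  have m5 := h.q1
  have m6 : (3 : F) * (t + 2) ≠ 0 := mul_ne_zero c3 h.a4
  have m7 : t * (2 * t + 3) ≠ 0 := mul_ne_zero t0 h.a5
  have m8 := h.q2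
  have m9 : t * (4 * t - 9) ≠ 0 := mul_ne_zero t0 h.a6
  have m10 : (3 : F) * (t + 5) ≠ 0 := mul_ne_zero c3 h.a7
  have m11 : t * (t - 9) ≠ 0 := mul_ne_zero t0 h.t9
  rw [e1, e2] at hk
  rcases hb with ⟨rfl, rfl⟩ | ⟨rfl, rfl⟩ | ⟨rfl, rfl⟩ | ⟨rfl, rfl⟩ <;>
  rcases ha with ⟨ha, rfl⟩ | ⟨ha, rfl⟩ | ⟨ha, rfl⟩ | ⟨ha, rfl⟩ <;>
  rw [ha] at hab hk
  · exact hab rfl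
  · exact m1 (by linear_combination -hk)
  · exact m2 (by linear_combination -hk)
  · exact m3 (by linear_combination -hk)
  · exact m4 (by linear_combination -hk)
  · exact hab rfl
  · exact m5 (by linear_combination hk)
  · exact m6 (by linear_combination -hk)
  · exact m7 (by linear_combination -hk)
  · exact m8 (by linear_combination hk)
  · exact hab rfl
  · exact m9 (by linear_combination hk)
  · exact m3 (by linear_combination -hk)
  · exact m10 (by linear_combination -hk)
  · exact m11 (by linear_combination hk)
  · exact hab rfl

theorem core2 (h : Nondeg t) {a b c y z w : F} (hb : IsH t b z) (ha : IsE t a y) (hc : IsE t c w)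
    (h1 : a + c = b + b) (h2 : y + w = z + z) : False := by
  obtain ⟨n0, n1, nt, n3, hk⟩ := hb
  have hk' : (a + c) * (y + w) = 12 * t := by rw [h1, h2]; linear_combination 4 * hk
  have c2 := h.c2
  have c3 := h.c3
  have t0 := h.t0
  have cancel : ∀ u : F, u + u = b + b → u = b := fun u hu =>
    mul_left_cancel₀ c2 (by linear_combination hu)
  have m1 : (3 : F) * (3 * t - 1) ≠ 0 := mul_ne_zero c3 h.a1
  have m2 : (2 * 2) * (t * (t - 3)) ≠ 0 := mul_ne_zero (mul_ne_zero c2 c2) (mul_ne_zero t0 h.t3)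
  have m3 : t * 3 ≠ 0 := mul_ne_zero t0 c3
  have m4 := h.q3
  have m5 : (2 * 2 * 3 : F) * (t - 1) ≠ 0 := mul_ne_zero (mul_ne_zero (mul_ne_zero c2 c2) c3) h.t1
  have m6 : t * (t - 9) ≠ 0 := mul_ne_zero t0 h.t9
  rcases ha with ⟨ha, rfl⟩ | ⟨ha, rfl⟩ | ⟨ha, rfl⟩ | ⟨ha, rfl⟩ <;>
  rcases hc with ⟨hc, rfl⟩ | ⟨hc, rfl⟩ | ⟨hc, rfl⟩ | ⟨hc, rfl⟩ <;>
  rw [ha, hc] at hk' h1 <;>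
  first
    | exact n0 (cancel _ h1).symm
    | exact n1 (cancel _ h1).symm
    | exact nt (cancel _ h1).symm
    | exact n3 (cancel _ h1).symm
    | exact m1 (by linear_combination -hk')
    | exact m2 (by linear_combination hk')
    | exact m3 (by linear_combination -hk')
    | exact m4 (by linear_combination hk')
    | exact m5 (by linear_combination -hk')
    | exact m6 (by linear_combination hk')

theorem core3 (h : Nondeg t) {a b c y z w : F} (hb : IsE t b z) (ha : IsE t a y) (hc : IsE t c w)
    (h1 : a + c = b + b) (h2 : y + w = z + z) (hab : a ≠ b) : False := by
  have c2 := h.c2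
  have c3 := h.c3
  have c5 := h.c5
  have c7 := h.c7
  have t0 := h.t0
  have d4 : (2 * 2 : F) ≠ 0 := mul_ne_zero c2 c2
  have d8 : (2 * 2 * 2 : F) ≠ 0 := mul_ne_zero d4 c2
  have cancel : ∀ u : F, u + u = b + b → u = b := fun u hu =>
    mul_left_cancel₀ c2 (by linear_combination hu)
  have hac : a ≠ c := fun hh => hab (cancel a (by rw [← h1, ← hh]))
  have hcb : c ≠ b := fun hh => hab (by linear_combination h1 - hh)
  rcases ha with ⟨ha, rfl⟩ | ⟨ha, rfl⟩ | ⟨ha, rfl⟩ | ⟨ha, rfl⟩ <;>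
  rcases hc with ⟨hc, rfl⟩ | ⟨hc, rfl⟩ | ⟨hc, rfl⟩ | ⟨hc, rfl⟩ <;>
  first
    | exact hac (ha.trans hc.symm)
    | skip
  all_goals
    rcases hb with ⟨hb, rfl⟩ | ⟨hb, rfl⟩ | ⟨hb, rfl⟩ | ⟨hb, rfl⟩ <;>
    first
      | exact hab (ha.trans hb.symm)
      | exact hcb (hc.trans hb.symm)
      | skip
  all_goals
    rw [ha, hb, hc] at h1
    first
      | exact one_ne_zero (α := F) (by linear_combination h1)
      | exact one_ne_zero (α := F) (by linear_combination -h1)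
      | exact c5 (by linear_combination h1)
      | exact c5 (by linear_combination -h1)
      | exact d4 (by linear_combination h1)
      | exact t0 (by linear_combination h2)
      | exact t0 (by linear_combination -h2)
      | exact mul_ne_zero d4 t0 (by linear_combination h2)
      | exact mul_ne_zero c5 t0 (by linear_combination -h2)
      | exact one_ne_zero (α := F) (by linear_combination h1 - h2)
      | exact one_ne_zero (α := F) (by linear_combination h2 - h1)
      | exact d8 (by linear_combination 5 * h1 + h2)
      | exact c2 (by linear_combination h2 - 4 * h1)
      | exact c7 (by linear_combination h1 - h2)
      | exact c7 (by linear_combination -h1 - 2 * h2)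
      | exact c7 (by linear_combination h1 + 2 * h2)
      | exact d8 (by linear_combination h2 - h1)

theorem core4 (h : Nondeg t) (n1 : ¬ IsSquare (1 - t)) (n2 : ¬ IsSquare (t * (t - 3)))
    {a b c y z w : F} (hb : IsE t b z) (ha : IsH t a y) (hc : IsH t c w)
    (h1 : a + c = b + b) (h2 : y + w = z + z) : False := by
  obtain ⟨a0, a1, at', a3, hka⟩ := ha
  obtain ⟨c0, c1, ct, c3', hkc⟩ := hc
  have c2 := h.c2
  have c3 := h.c3
  have t0 := h.t0
  -- `3 t (a + c) = a c (y + w)`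
  have key : 3 * t * b = a * c * z := by
    apply mul_left_cancel₀ c2
    linear_combination (-(3 * t)) * h1 + a * c * h2 - c * hka - a * hkc
  have hc' : c = b + b - a := by linear_combination h1
  rw [hc'] at key
  rcases hb with ⟨rfl, rfl⟩ | ⟨rfl, rfl⟩ | ⟨rfl, rfl⟩ | ⟨rfl, rfl⟩
  · have : (3 * t) * (a * a) = 0 := by linear_combination key
    simp [c3, t0, a0] at this
  · apply n1
    refine ⟨1 - a, ?_⟩
    apply mul_left_cancel₀ c3
    linear_combination -key
  · apply n2
    refine ⟨z - a, ?_⟩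
    apply mul_left_cancel₀ t0
    linear_combination -key
  · have : (3 * 3) * t = 0 := by linear_combination key
    simp [c3, t0] at this

theorem core5 (h : Nondeg t) (n1 : ¬ IsSquare ((1 - t) * (1 - 9 * t)))
    (n2 : ¬ IsSquare ((t - 3) * (t - 27)))
    {a b c y z w : F} (ha : IsE t a y) (hb : IsH t b z) (hc : IsH t c w)
    (h1 : a + c = b + b) (h2 : y + w = z + z) : False := by
  obtain ⟨b0, b1, bt, b3, hkb⟩ := hb
  obtain ⟨c0, c1, ct, c3', hkc⟩ := hc
  have c2 := h.c2
  have c3 := h.c3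
  have t0 := h.t0
  have hc' : c = b + b - a := by linear_combination h1
  have key : y * b * c + 3 * t * b = 2 * (3 * t) * c := by
    linear_combination b * c * h2 - b * hkc + 2 * c * hkb
  rw [hc'] at key
  rcases ha with ⟨rfl, rfl⟩ | ⟨rfl, rfl⟩ | ⟨rfl, rfl⟩ | ⟨rfl, rfl⟩
  · have : (3 * t) * b * (2 * b - 3) = 0 := by linear_combination key
    simp [c3, t0, b0] at this
    exact c3' (by rw [hc']; linear_combination this)
  · apply n1
    refine ⟨4 * b - (1 + 3 * t), ?_⟩
    apply mul_left_cancel₀ c3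
    linear_combination -8 * key
  · apply n2
    refine ⟨4 * b - (y + 9), ?_⟩
    apply mul_left_cancel₀ t0
    linear_combination -8 * key
  · have : (3 * 3 * t) * (b - 2) = 0 := by linear_combination -key
    simp [c3, t0] at this
    exact c1 (by rw [hc']; linear_combination 2 * this)

theorem core6 (h : Nondeg t) {a b c y z w : F} (ha : IsH t a y) (hb : IsH t b z) (hc : IsH t c w)
    (h1 : a + c = b + b) (h2 : y + w = z + z) (hab : a ≠ b) : False := by
  obtain ⟨a0, -, -, -, hka⟩ := ha
  obtain ⟨b0, -, -, -, hkb⟩ := hb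
  obtain ⟨c0, -, -, -, hkc⟩ := hc
  have c2 := h.c2
  have c3 := h.c3
  have t0 := h.t0
  have hc' : c = b + b - a := by linear_combination h1
  have key : 3 * t * (b * b - a * c) = 0 := by
    apply mul_left_cancel₀ c2
    linear_combination (-(3 * t) * b) * h1 + a * c * b * h2 - c * b * hka - a * b * hkc
      + 2 * a * c * hkb
  rw [hc'] at key
  have : (3 * t) * ((b - a) * (b - a)) = 0 := by linear_combination key
  simp [c3, t0, sub_eq_zero] at this
  exact hab this.symm

open Classical in
/-- The modified inversion. -/
noncomputable def fn (t x : F) : F :=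
  if x = 0 then 3 * t else if x = 1 then 3 else if x = t then t else if x = 3 then 0 else 3 * t / x

theorem fn_spec (t x : F) : IsE t x (fn t x) ∨ IsH t x (fn t x) := by
  unfold fn IsE IsH
  split_ifs with h0 h1 ht h3
  · simp [h0]
  · simp [h1]
  · simp [ht]
  · simp [h3]
  · right
    exact ⟨h0, h1, ht, h3, by field_simp⟩

theorem fn_inj (h : Nondeg t) : Function.Injective (fn t) := by
  have c3 := h.c3
  have t0 := h.t0
  have t1 := h.t1
  have t3 := h.t3
  have HE : ∀ a b y : F, IsH t a y → IsE t b y → False := by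
    rintro a b y ⟨a0, a1, at', a3, hk⟩ hb
    rcases hb with ⟨-, rfl⟩ | ⟨-, rfl⟩ | ⟨-, rfl⟩ | ⟨-, rfl⟩
    · exact a1 (mul_right_cancel₀ (mul_ne_zero c3 t0) (by linear_combination hk))
    · exact at' (mul_right_cancel₀ c3 (by linear_combination hk))
    · exact a3 (mul_right_cancel₀ t0 hk)
    · exact mul_ne_zero c3 t0 (by linear_combination -hk)
  intro a b hab
  have ha := fn_spec t a
  have hb := fn_spec t b
  rw [hab] at ha
  generalize fn t b = y at ha hb
  rcases ha with ha | ha <;> rcases hb with hb | hb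
  · rcases ha with ⟨rfl, e⟩ | ⟨rfl, e⟩ | ⟨rfl, e⟩ | ⟨rfl, e⟩ <;>
    rcases hb with ⟨hb, e'⟩ | ⟨hb, e'⟩ | ⟨hb, e'⟩ | ⟨hb, e'⟩ <;>
    rw [hb] <;> rw [e] at e' <;> exfalso <;>
    first
      | exact mul_ne_zero c3 t1 (by linear_combination e')
      | exact mul_ne_zero c3 t1 (by linear_combination -e')
      | exact mul_ne_zero h.c2 t0 (by linear_combination e')
      | exact mul_ne_zero h.c2 t0 (by linear_combination -e')
      | exact mul_ne_zero c3 t0 (by linear_combination e')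
      | exact mul_ne_zero c3 t0 (by linear_combination -e')
      | exact t3 (by linear_combination e')
      | exact t3 (by linear_combination -e')
      | exact c3 (by linear_combination e')
      | exact c3 (by linear_combination -e')
      | exact t0 (by linear_combination e')
      | exact t0 (by linear_combination -e')
  · exact (HE _ _ _ hb ha).elim
  · exact (HE _ _ _ ha hb).elim
  · obtain ⟨a0, -, -, -, hka⟩ := ha
    obtain ⟨b0, -, -, -, hkb⟩ := hb
    have hy : y ≠ 0 := by
      rintro rfl
      exact mul_ne_zero c3 t0 (by linear_combination -hka)
    exact mul_right_cancel₀ hy (by rw [hka, hkb])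

theorem hasAPD_of_param (h : Nondeg t) (n1 : ¬ IsSquare (1 - t)) (n2 : ¬ IsSquare (t * (t - 3)))
    (n3 : ¬ IsSquare ((1 - t) * (1 - 9 * t))) (n4 : ¬ IsSquare ((t - 3) * (t - 27))) :
    HasAPD F := by
  refine ⟨fn t, fn_inj h, ?_⟩
  intro x d hd h2
  have h1 : (x - d) + (x + d) = x + x := by ring
  have h1' : (x + d) + (x - d) = x + x := by ring
  have h2' : fn t (x + d) + fn t (x - d) = fn t x + fn t x := by rw [add_comm]; exact h2
  have hab : x - d ≠ x := by simpa using hd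
  have hab' : x + d ≠ x := by simpa using hd
  rcases fn_spec t (x - d) with ha | ha <;> rcases fn_spec t x with hb | hb <;>
    rcases fn_spec t (x + d) with hc | hc
  · exact core3 h hb ha hc h1 h2 hab
  · exact core1 h hb ha hc h1 h2 hab
  · exact core2 h hb ha hc h1 h2
  · exact core5 h n3 n4 ha hb hc h1 h2
  · exact core1 h hb hc ha h1' h2' hab'
  · exact core4 h n1 n2 hb ha hc h1 h2
  · exact core5 h n3 n4 hc hb ha h1' h2'
  · exact core6 h ha hb hc h1 h2 hab

end APD

namespace Step

open Polynomial

section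
variable {F : Type} [Field F]

/-- The twisted derivation attached to `f` and `c`. -/
noncomputable def T (f : F[X]) (c : F) : F[X] →ₗ[F] F[X] where
  toFun k := f * derivative k + C c * derivative f * k
  map_add' a b := by simp only [derivative_add]; ring
  map_smul' r a := by
    simp only [smul_eq_C_mul, derivative_C_mul, RingHom.id_apply, mul_add]
    ring

theorem T_apply (f : F[X]) (c : F) (k : F[X]) :
    T f c k = f * derivative k + C c * derivative f * k := rfl

theorem natDegree_T_le (f : F[X]) (hf : f.natDegree ≤ 3) (c : F) (k : F[X]) (n : ℕ)
    (hk : k.natDegree ≤ n) : (T f c k).natDegree ≤ n + 2 := by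
  rw [T_apply]
  refine (natDegree_add_le _ _).trans (max_le ?_ ?_)
  · by_cases h0 : k.natDegree = 0
    · rw [natDegree_eq_zero] at h0
      obtain ⟨a, rfl⟩ := h0
      simp
    · have := natDegree_derivative_le k
      have := natDegree_mul_le (p := f) (q := derivative k)
      omega
  · have h1 := natDegree_derivative_le f
    have h2 := natDegree_C_mul_le c (derivative f)
    have := natDegree_mul_le (p := C c * derivative f) (q := k)
    omega

theorem natDegree_T_pow_le (f : F[X]) (hf : f.natDegree ≤ 3) (c : F) (k : F[X]) (n : ℕ)
    (hk : k.natDegree ≤ n) (i : ℕ) : ((T f c)^[i] k).natDegree ≤ n + 2 * i := by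
  induction i with
  | zero => simpa using hk
  | succ i ih =>
    rw [Function.iterate_succ_apply']
    have := natDegree_T_le f hf c _ _ ih
    omega

theorem T_iter_add (f : F[X]) (c : F) (i : ℕ) (a b : F[X]) :
    (T f c)^[i] (a + b) = (T f c)^[i] a + (T f c)^[i] b := by
  induction i generalizing a b with
  | zero => rfl
  | succ i ih => simp only [Function.iterate_succ_apply, map_add, ih]

theorem T_iter_smul (f : F[X]) (c : F) (i : ℕ) (r : F) (b : F[X]) :
    (T f c)^[i] (r • b) = r • (T f c)^[i] b := by
  induction i generalizing b with
  | zero => rfl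
  | succ i ih => simp only [Function.iterate_succ_apply, map_smul, ih]

/-- The derivation `θ = f d/dX`. -/
noncomputable def th (f : F[X]) (k : F[X]) : F[X] := f * derivative k

theorem th_ne (f : F[X]) (x : F) (hx : f.eval x ≠ 0) (p : ℕ) [CharP F p] (m : ℕ) (hm : m < p)
    (Q : F[X]) (hQ : Q.eval x ≠ 0) : ((th f)^[m] ((X - C x) ^ m * Q)).eval x ≠ 0 := by
  induction m generalizing Q with
  | zero => simpa using hQ
  | succ m ih =>
    rw [Function.iterate_succ_apply]
    have e : th f ((X - C x) ^ (m + 1) * Q) =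
        (X - C x) ^ m * (C ((m : F) + 1) * f * Q + (X - C x) * f * derivative Q) := by
      rw [th, derivative_mul, derivative_X_sub_C_pow]
      simp only [Nat.add_sub_cancel, map_add, map_natCast, map_one, Nat.cast_add, Nat.cast_one]
      ring
    rw [e]
    apply ih (by omega)
    have : ((m : F) + 1) ≠ 0 := by
      intro h
      have h' : ((m + 1 : ℕ) : F) = 0 := by exact_mod_cast h
      rw [CharP.cast_eq_zero_iff F p] at h'
      have := Nat.le_of_dvd (by omega) h'
      omega
    simp [this, hx, hQ]

theorem le_rootMultiplicity (f : F[X]) (x : F) (hx : f.eval x ≠ 0) (p : ℕ) [CharP F p] (l : ℕ)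
    (hl : l ≤ p) (P : F[X]) (hP : P ≠ 0) (h : ∀ i < l, ((th f)^[i] P).eval x = 0) :
    l ≤ P.rootMultiplicity x := by
  by_contra! hlt
  obtain ⟨Q, hQ, hnd⟩ := exists_eq_pow_rootMultiplicity_mul_and_not_dvd P hP x
  have hQx : Q.eval x ≠ 0 := by
    intro h0
    exact hnd (dvd_iff_isRoot.2 h0)
  have := th_ne f x hx p _ (lt_of_lt_of_le hlt hl) Q hQx
  rw [← hQ] at this
  exact this (h _ hlt)

theorem card_mul_le [DecidableEq F] (P : F[X]) (l : ℕ) (N : Finset F)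
    (h : ∀ x ∈ N, l ≤ P.rootMultiplicity x) : N.card * l ≤ P.natDegree := by
  have h1 : l • N.val ≤ P.roots := by
    rw [Multiset.le_iff_count]
    intro x
    rw [Multiset.count_nsmul, count_roots]
    by_cases hx : x ∈ N
    · rw [Multiset.count_eq_one_of_mem N.nodup hx]
      simpa using h x hx
    · rw [Multiset.count_eq_zero_of_notMem hx]
      simp
  have h2 := Multiset.card_le_card h1
  rw [Multiset.card_nsmul] at h2
  have h3 := card_roots' P
  have h4 : N.val.card = N.card := rfl
  rw [h4] at h2
  linarith [mul_comm l N.card]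

end

section
variable {p : ℕ} [Fact p.Prime]

/-- The auxiliary polynomial. -/
noncomputable def Phi (J q : ℕ) (f : (ZMod p)[X]) (A B : Fin J → (ZMod p)[X]) : (ZMod p)[X] :=
  ∑ j : Fin J, (A j + f ^ q * B j) * X ^ ((j : ℕ) * p)

theorem th_Phi (J q : ℕ) (hq : 0 < q) (f : (ZMod p)[X]) (A B : Fin J → (ZMod p)[X]) :
    th f (Phi J q f A B) = Phi J q f (fun j => T f 0 (A j)) (fun j => T f (q : ZMod p) (B j)) := by
  unfold th Phi
  rw [derivative_sum, Finset.mul_sum]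
  refine Finset.sum_congr rfl fun j _ => ?_
  beta_reduce
  rw [derivative_mul, derivative_X_pow, T_apply, T_apply]
  have : (((j : ℕ) * p : ℕ) : ZMod p) = 0 := by simp
  rw [this]
  obtain ⟨r, rfl⟩ : ∃ r, q = r + 1 := ⟨q - 1, by omega⟩
  rw [derivative_add, derivative_mul, derivative_pow]
  simp only [Nat.add_sub_cancel, map_zero, zero_mul, mul_zero, add_zero, map_natCast]
  ring

theorem th_iter_Phi (J q : ℕ) (hq : 0 < q) (f : (ZMod p)[X]) (A B : Fin J → (ZMod p)[X]) (i : ℕ) :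
    (th f)^[i] (Phi J q f A B) =
      Phi J q f (fun j => (T f 0)^[i] (A j)) (fun j => (T f (q : ZMod p))^[i] (B j)) := by
  induction i with
  | zero => rfl
  | succ i ih =>
    rw [Function.iterate_succ_apply', ih, th_Phi _ _ hq]
    simp only [Function.iterate_succ_apply']

/-- The reduced polynomial. -/
noncomputable def Red (J q : ℕ) (f : (ZMod p)[X]) (e : ZMod p) (A B : Fin J → (ZMod p)[X])
    (i : ℕ) : (ZMod p)[X] :=
  ∑ j : Fin J, ((T f 0)^[i] (A j) + e • (T f (q : ZMod p))^[i] (B j)) * X ^ (j : ℕ)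

theorem eval_th_iter (J q : ℕ) (hq : 0 < q) (f : (ZMod p)[X]) (A B : Fin J → (ZMod p)[X]) (i : ℕ)
    (e x : ZMod p) (hx : (f.eval x) ^ q = e) :
    ((th f)^[i] (Phi J q f A B)).eval x = (Red J q f e A B i).eval x := by
  rw [th_iter_Phi _ _ hq]
  unfold Phi Red
  rw [eval_finsetSum, eval_finsetSum]
  refine Finset.sum_congr rfl fun j _ => ?_
  have : x ^ ((j : ℕ) * p) = x ^ (j : ℕ) := by rw [mul_comm, pow_mul, ZMod.pow_card]
  simp [hx, this]

theorem natDegree_Red (J q : ℕ) (f : (ZMod p)[X]) (hf : f.natDegree ≤ 3) (e : ZMod p)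
    (A B : Fin J → (ZMod p)[X]) (n : ℕ) (hA : ∀ j, (A j).natDegree ≤ n)
    (hB : ∀ j, (B j).natDegree ≤ n) (i : ℕ) : (Red J q f e A B i).natDegree ≤ n + 2 * i + J := by
  unfold Red
  refine natDegree_sum_le_of_forall_le _ _ fun j _ => ?_
  have h1 := natDegree_T_pow_le f hf 0 (A j) n (hA j) i
  have h2 := natDegree_T_pow_le f hf (q : ZMod p) (B j) n (hB j) i
  have h3 := natDegree_smul_le e ((T f (q : ZMod p))^[i] (B j))
  have h4 := natDegree_add_le_of_degree_le h1 (h3.trans h2)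
  have h5 := natDegree_mul_le (p := (T f 0)^[i] (A j) + e • (T f (q : ZMod p))^[i] (B j))
    (q := X ^ (j : ℕ))
  rw [natDegree_X_pow] at h5
  have := j.2
  omega

/-- The individual terms of the auxiliary polynomial. -/
noncomputable def term (J q : ℕ) (f : (ZMod p)[X]) (A B : Fin J → (ZMod p)[X])
    (s : Fin J × Bool) : (ZMod p)[X] :=
  (if s.2 then f ^ q * B s.1 else A s.1) * X ^ ((s.1 : ℕ) * p)

theorem Phi_eq (J q : ℕ) (f : (ZMod p)[X]) (A B : Fin J → (ZMod p)[X]) :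
    Phi J q f A B = ∑ s, term J q f A B s := by
  rw [Fintype.sum_prod_type]
  unfold Phi term
  refine Finset.sum_congr rfl fun j _ => ?_
  rw [Fintype.sum_bool]
  simp only [if_true, Bool.false_eq_true, if_false]
  ring

theorem natDegree_term_false (J h : ℕ) (f : (ZMod p)[X])
    (A B : Fin J → (ZMod p)[X]) (j : Fin J) (hA : (A j).natDegree < h)
    (h0 : term J (h + 1) f A B (j, false) ≠ 0) :
    ∃ a < h, (term J (h + 1) f A B (j, false)).natDegree = a + j * p := by
  refine ⟨_, hA, ?_⟩
  have hA0 : A j ≠ 0 := by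
    rintro e
    simp [term, e] at h0
  simp [term, natDegree_mul hA0]

theorem natDegree_term_true (J h : ℕ) (hp : p = 2 * h + 3) (f : (ZMod p)[X]) (hf : f.natDegree = 3)
    (A B : Fin J → (ZMod p)[X]) (j : Fin J) (hB : (B j).natDegree < h)
    (h0 : term J (h + 1) f A B (j, true) ≠ 0) :
    ∃ a < h, (term J (h + 1) f A B (j, true)).natDegree = (h + a) + (j + 1) * p := by
  refine ⟨_, hB, ?_⟩
  have hB0 : B j ≠ 0 := by
    rintro e
    simp [term, e] at h0
  have hf0 : f ^ (h + 1) ≠ 0 := by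
    apply pow_ne_zero
    rintro rfl
    simp at hf
  have : ((j : ℕ) + 1) * p = j * p + p := by ring
  simp only [term, if_true]
  rw [natDegree_mul (mul_ne_zero hf0 hB0) (pow_ne_zero _ X_ne_zero), natDegree_mul hf0 hB0,
    natDegree_pow, hf, natDegree_X_pow, this]
  omega

theorem divmod_inj {a b j k : ℕ} (ha : a < p) (hb : b < p) (h : a + j * p = b + k * p) :
    a = b ∧ j = k := by
  have hp : 0 < p := by omega
  have h1 := congrArg (· % p) h
  have h2 := congrArg (· / p) h
  simp only [Nat.add_mul_mod_self_right, Nat.add_mul_div_right _ _ hp, Nat.mod_eq_of_lt ha,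
    Nat.mod_eq_of_lt hb, Nat.div_eq_of_lt ha, Nat.div_eq_of_lt hb] at h1 h2
  omega

theorem terms_disjoint (J h : ℕ) (hp : p = 2 * h + 3) (f : (ZMod p)[X]) (hf : f.natDegree = 3)
    (A B : Fin J → (ZMod p)[X]) (hA : ∀ j, (A j).natDegree < h) (hB : ∀ j, (B j).natDegree < h) :
    Set.Pairwise {s | s ∈ Finset.univ ∧ term J (h + 1) f A B s ≠ 0}
      (Function.onFun Ne (degree ∘ term J (h + 1) f A B)) := by
  rintro ⟨j, u⟩ ⟨-, hs⟩ ⟨k, v⟩ ⟨-, ht⟩ hne heq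
  have heq' := natDegree_eq_of_degree_eq heq
  apply hne
  rcases u with _ | _ <;> rcases v with _ | _
  · obtain ⟨a, ha, ea⟩ := natDegree_term_false J h f A B j (hA j) hs
    obtain ⟨b, hb, eb⟩ := natDegree_term_false J h f A B k (hA k) ht
    rw [ea, eb] at heq'
    have := (divmod_inj (by omega) (by omega) heq').2
    rw [Fin.ext this]
  · obtain ⟨a, ha, ea⟩ := natDegree_term_false J h f A B j (hA j) hs
    obtain ⟨b, hb, eb⟩ := natDegree_term_true J h hp f hf A B k (hB k) ht
    rw [ea, eb] at heq'
    have := (divmod_inj (by omega) (by omega) heq').1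
    omega
  · obtain ⟨a, ha, ea⟩ := natDegree_term_true J h hp f hf A B j (hB j) hs
    obtain ⟨b, hb, eb⟩ := natDegree_term_false J h f A B k (hA k) ht
    rw [ea, eb] at heq'
    have := (divmod_inj (by omega) (by omega) heq').1
    omega
  · obtain ⟨a, ha, ea⟩ := natDegree_term_true J h hp f hf A B j (hB j) hs
    obtain ⟨b, hb, eb⟩ := natDegree_term_true J h hp f hf A B k (hB k) ht
    rw [ea, eb] at heq'
    have := (divmod_inj (by omega) (by omega) heq').2
    rw [Fin.ext (show (j : ℕ) = k by omega)]

theorem Phi_ne_zero (J h : ℕ) (hp : p = 2 * h + 3) (f : (ZMod p)[X]) (hf : f.natDegree = 3)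
    (A B : Fin J → (ZMod p)[X]) (hA : ∀ j, (A j).natDegree < h) (hB : ∀ j, (B j).natDegree < h)
    (hne : ∃ j, A j ≠ 0 ∨ B j ≠ 0) : Phi J (h + 1) f A B ≠ 0 := by
  intro h0
  rw [Phi_eq] at h0
  have h1 := degree_sum_eq_of_disjoint _ _ (terms_disjoint J h hp f hf A B hA hB)
  rw [h0, degree_zero] at h1
  have h2 : ∀ s, term J (h + 1) f A B s = 0 := by
    intro s
    rw [← degree_eq_bot]
    have := Finset.le_sup (f := fun i => degree (term J (h + 1) f A B i)) (Finset.mem_univ s)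
    rw [← h1] at this
    exact le_bot_iff.1 this
  have hf0 : f ≠ 0 := by
    rintro rfl
    simp at hf
  obtain ⟨j, hj | hj⟩ := hne
  · have := h2 (j, false)
    simp [term, hj] at this
  · have := h2 (j, true)
    simp [term, hj, hf0] at this

theorem natDegree_Phi (J h : ℕ) (hp : p = 2 * h + 3) (f : (ZMod p)[X]) (hf : f.natDegree = 3)
    (A B : Fin J → (ZMod p)[X]) (hA : ∀ j, (A j).natDegree < h) (hB : ∀ j, (B j).natDegree < h)
    (hpos : 0 < h) : (Phi J (h + 1) f A B).natDegree + 4 ≤ (J + 1) * p := by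
  have hp2 : (J + 1) * p = J * p + p := by ring
  suffices (Phi J (h + 1) f A B).natDegree ≤ J * p + (p - 4) by
    omega
  rw [Phi_eq]
  refine natDegree_sum_le_of_forall_le _ _ ?_
  rintro ⟨j, u⟩ -
  by_cases h0 : term J (h + 1) f A B (j, u) = 0
  · simp [h0]
  have hj : (j : ℕ) + 1 ≤ J := j.2
  have hj2 := Nat.mul_le_mul_right p hj
  have hj3 : ((j : ℕ) + 1) * p = j * p + p := by ring
  rcases u with _ | _
  · obtain ⟨a, ha, ea⟩ := natDegree_term_false J h f A B j (hA j) h0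
    omega
  · obtain ⟨a, ha, ea⟩ := natDegree_term_true J h hp f hf A B j (hB j) h0
    omega

/-- The space of unknowns. -/
abbrev V (p : ℕ) [Fact p.Prime] (J h : ℕ) : Type :=
  Fin J → (degreeLT (ZMod p) h × degreeLT (ZMod p) h)

/-- The system of linear equations. -/
noncomputable def L (J h l q : ℕ) (f : (ZMod p)[X]) (e : ZMod p) :
    V p J h →ₗ[ZMod p] ((Σ i : Fin l, Fin (h + 2 * i + J)) → ZMod p) where
  toFun v := fun s => (Red J q f e (fun j => ((v j).1 : (ZMod p)[X]))
    (fun j => ((v j).2 : (ZMod p)[X])) s.1).coeff s.2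
  map_add' v w := by
    funext s
    rw [Pi.add_apply, ← coeff_add]
    congr 1
    unfold Red
    rw [← Finset.sum_add_distrib]
    refine Finset.sum_congr rfl fun j _ => ?_
    simp only [Pi.add_apply, Prod.fst_add, Prod.snd_add, Submodule.coe_add, T_iter_add, smul_add]
    ring
  map_smul' r v := by
    funext s
    rw [Pi.smul_apply, ← coeff_smul]
    congr 1
    unfold Red
    rw [Finset.smul_sum]
    refine Finset.sum_congr rfl fun j _ => ?_
    simp only [Pi.smul_apply, Prod.smul_fst, Prod.smul_snd, Submodule.coe_smul, T_iter_smul,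
      RingHom.id_apply]
    simp only [smul_eq_C_mul]
    ring

theorem exists_kernel (J h l q : ℕ) (f : (ZMod p)[X]) (e : ZMod p)
    (hdim : ∑ i : Fin l, (h + 2 * (i : ℕ) + J) < J * (h + h)) :
    ∃ v : V p J h, v ≠ 0 ∧ L J h l q f e v = 0 := by
  have hfr : Module.finrank (ZMod p) (degreeLT (ZMod p) h) = h := by
    rw [(degreeLTEquiv (ZMod p) h).finrank_eq, Module.finrank_fin_fun]
  have : Module.Finite (ZMod p) (degreeLT (ZMod p) h) :=
    Module.Finite.equiv (degreeLTEquiv (ZMod p) h).symm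
  have hV : Module.finrank (ZMod p) (V p J h) = J * (h + h) := by
    rw [Module.finrank_pi_fintype]
    simp [Module.finrank_prod, hfr]
  have hW : Module.finrank (ZMod p) ((Σ i : Fin l, Fin (h + 2 * i + J)) → ZMod p) =
      ∑ i : Fin l, (h + 2 * (i : ℕ) + J) := by
    rw [Module.finrank_fintype_fun_eq_card, Fintype.card_sigma]
    simp only [Fintype.card_fin]
  have := LinearMap.ker_ne_bot_of_finrank_lt (f := L J h l q f e) (by rw [hV, hW]; exact hdim)
  obtain ⟨v, hv, hv0⟩ := Submodule.exists_mem_ne_zero_of_ne_bot this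
  exact ⟨v, hv0, hv⟩

theorem stepanov_gen (J h l : ℕ) (hh : 0 < h) (hp : p = 2 * h + 3) (hl : l ≤ p)
    (hdim : ∑ i : Fin l, (h + 2 * (i : ℕ) + J) < J * (h + h))
    (f : (ZMod p)[X]) (hf : f.natDegree = 3) (e : ZMod p) (he : e ≠ 0) (N : Finset (ZMod p))
    (hN : ∀ x ∈ N, (f.eval x) ^ (h + 1) = e) : N.card * l + 4 ≤ (J + 1) * p := by
  obtain ⟨v, hv0, hv⟩ := exists_kernel J h l (h + 1) f e hdim
  set A : Fin J → (ZMod p)[X] := fun j => ((v j).1 : (ZMod p)[X]) with hAdef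
  set B : Fin J → (ZMod p)[X] := fun j => ((v j).2 : (ZMod p)[X]) with hBdef
  have hlt : ∀ P : degreeLT (ZMod p) h, (P : (ZMod p)[X]).natDegree < h := by
    intro P
    by_cases h0 : (P : (ZMod p)[X]) = 0
    · rw [h0]; simpa using hh
    · exact (natDegree_lt_iff_degree_lt h0).2 (mem_degreeLT.1 P.2)
  have hA : ∀ j, (A j).natDegree < h := fun j => hlt _
  have hB : ∀ j, (B j).natDegree < h := fun j => hlt _
  have hne : ∃ j, A j ≠ 0 ∨ B j ≠ 0 := by
    by_contra! hc
    apply hv0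
    funext j
    obtain ⟨h1, h2⟩ := hc j
    exact Prod.ext (Subtype.ext h1) (Subtype.ext h2)
  have hPhi := Phi_ne_zero J h hp f hf A B hA hB hne
  have hdeg := natDegree_Phi J h hp f hf A B hA hB hh
  have hRed : ∀ i < l, Red J (h + 1) f e A B i = 0 := by
    intro i hi
    ext m
    rw [coeff_zero]
    by_cases hm : m < h + 2 * i + J
    · exact congrFun hv ⟨⟨i, hi⟩, ⟨m, hm⟩⟩
    · apply coeff_eq_zero_of_natDegree_lt
      have := natDegree_Red J (h + 1) f hf.le e A B (h - 1) (fun j => by have := hA j; omega)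
        (fun j => by have := hB j; omega) i
      omega
  have hmult : ∀ x ∈ N, l ≤ (Phi J (h + 1) f A B).rootMultiplicity x := by
    intro x hx
    refine le_rootMultiplicity f x ?_ p l hl _ hPhi ?_
    · intro h0
      have := hN x hx
      rw [h0, zero_pow (by omega)] at this
      exact he this.symm
    · intro i hi
      rw [eval_th_iter J (h + 1) (by omega) f A B i e x (hN x hx), hRed i hi, eval_zero]
  have := card_mul_le _ l N hmult
  omega

theorem stepanov (h : ℕ) (hp : p = 2 * h + 3) (hbig : 3000 ≤ p)
    (f : (ZMod p)[X]) (hf : f.natDegree = 3) (e : ZMod p) (he : e ≠ 0) (N : Finset (ZMod p))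
    (hN : ∀ x ∈ N, (f.eval x) ^ (h + 1) = e) : N.card * 44 + 4 ≤ 24 * p := by
  refine stepanov_gen 23 h 44 (by omega) hp (by omega) ?_ f hf e he N hN
  rw [Fin.sum_univ_eq_sum_range (fun i => h + 2 * i + 23) 44]
  simp only [Finset.sum_range_succ, Finset.sum_range_zero]
  omega

theorem cubic_sum (hbig : 3000 ≤ p) (a b c : ZMod p) :
    11 * |∑ x : ZMod p, quadraticChar (ZMod p) ((x - a) * (x - b) * (x - c))| ≤ (p : ℤ) + 33 := by
  have hpp : p.Prime := Fact.out
  have hodd : p % 2 = 1 := by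
    rcases hpp.eq_two_or_odd with h | h <;> omega
  obtain ⟨h, hp⟩ : ∃ h, p = 2 * h + 3 := ⟨(p - 3) / 2, by omega⟩
  have hchar : ringChar (ZMod p) ≠ 2 := by
    rw [ZMod.ringChar_zmod_n]
    omega
  have hpow : ∀ y : ZMod p, ((quadraticChar (ZMod p) y : ℤ) : ZMod p) = y ^ (h + 1) := by
    intro y
    rw [quadraticChar_eq_pow_of_char_ne_two' hchar, ZMod.card]
    congr 1
    omega
  set f : (ZMod p)[X] := (X - C a) * (X - C b) * (X - C c) with hf
  have hdeg : f.natDegree = 3 := by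
    rw [hf, natDegree_mul (mul_ne_zero (X_sub_C_ne_zero a) (X_sub_C_ne_zero b)) (X_sub_C_ne_zero c),
      natDegree_mul (X_sub_C_ne_zero a) (X_sub_C_ne_zero b)]
    simp only [natDegree_X_sub_C]
  have hev : ∀ x, f.eval x = (x - a) * (x - b) * (x - c) := by
    intro x; simp [hf]
  set g : ZMod p → ℤ := fun x => quadraticChar (ZMod p) ((x - a) * (x - b) * (x - c)) with hg
  have h1 := stepanov h hp hbig f hdeg 1 one_ne_zero (Finset.univ.filter fun x => g x = 1) (by
    intro x hx
    have hx' : g x = 1 := (Finset.mem_filter.1 hx).2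
    rw [hev, ← hpow]
    change ((g x : ℤ) : ZMod p) = 1
    rw [hx']; simp)
  have h2 := stepanov h hp hbig f hdeg (-1) (neg_ne_zero.2 one_ne_zero)
    (Finset.univ.filter fun x => g x = -1) (by
    intro x hx
    have hx' : g x = -1 := (Finset.mem_filter.1 hx).2
    rw [hev, ← hpow]
    change ((g x : ℤ) : ZMod p) = -1
    rw [hx']; simp)
  have h3 : (Finset.univ.filter fun x => g x = 0).card ≤ 3 := by
    refine (Finset.card_le_card (t := {a, b, c}) ?_).trans Finset.card_le_three
    intro x hx
    have hx' : g x = 0 := (Finset.mem_filter.1 hx).2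
    simp only [hg, quadraticChar_eq_zero_iff, mul_eq_zero, sub_eq_zero] at hx'
    simp only [Finset.mem_insert, Finset.mem_singleton]
    tauto
  have htri : ∀ x, g x = 0 ∨ g x = 1 ∨ g x = -1 := by
    intro x
    by_cases hx : (x - a) * (x - b) * (x - c) = 0
    · left; simp only [hg, hx]; exact quadraticChar_zero
    · right; exact quadraticChar_dichotomy hx
  have e1 : ∑ x, g x = ((Finset.univ.filter fun x => g x = 1).card : ℤ)
      - (Finset.univ.filter fun x => g x = -1).card := by
    rw [Finset.card_filter, Finset.card_filter]
    push_cast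
    rw [← Finset.sum_sub_distrib]
    refine Finset.sum_congr rfl fun x _ => ?_
    rcases htri x with h | h | h <;> rw [h] <;> norm_num
  have e2 : (p : ℤ) = ((Finset.univ.filter fun x => g x = 1).card : ℤ)
      + (Finset.univ.filter fun x => g x = -1).card
      + (Finset.univ.filter fun x => g x = 0).card := by
    have : (p : ℤ) = ∑ x : ZMod p, (1 : ℤ) := by simp [ZMod.card]
    rw [this, Finset.card_filter, Finset.card_filter, Finset.card_filter]
    push_cast
    rw [← Finset.sum_add_distrib, ← Finset.sum_add_distrib]
    refine Finset.sum_congr rfl fun x _ => ?_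
    rcases htri x with h | h | h <;> rw [h] <;> norm_num
  rw [e1]
  have h1' : ((Finset.univ.filter fun x => g x = 1).card : ℤ) * 44 + 4 ≤ 24 * p := by
    exact_mod_cast h1
  have h2' : ((Finset.univ.filter fun x => g x = -1).card : ℤ) * 44 + 4 ≤ 24 * p := by
    exact_mod_cast h2
  have h3' : ((Finset.univ.filter fun x => g x = 0).card : ℤ) ≤ 3 := by exact_mod_cast h3
  rcases abs_cases (((Finset.univ.filter fun x => g x = 1).card : ℤ)
      - (Finset.univ.filter fun x => g x = -1).card) with ⟨h, -⟩ | ⟨h, -⟩ <;> rw [h] <;> linarith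

end

end Step

namespace Step

section
variable {p : ℕ} [Fact p.Prime]

theorem nat_ne (n : ℕ) (h0 : 0 < n) (hn : n < p) : (n : ZMod p) ≠ 0 := by
  intro h
  rw [ZMod.natCast_eq_zero_iff] at h
  exact absurd (Nat.le_of_dvd h0 h) (by omega)

theorem chi_sq {x : ZMod p} (hx : x ≠ 0) :
    quadraticChar (ZMod p) x * quadraticChar (ZMod p) x = 1 := by
  have := quadraticChar_sq_one hx
  rw [← this]; ring

theorem chi_abs (x : ZMod p) : |quadraticChar (ZMod p) x| ≤ 1 := by
  by_cases hx : x = 0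
  · rw [hx, quadraticChar_zero]; simp
  · rcases quadraticChar_dichotomy hx with h | h <;> rw [h] <;> simp

theorem shift_sum (g : ZMod p → ℤ) (e : ZMod p) : ∑ x, g x = ∑ u, g (u + e) :=
  (Equiv.sum_comp (Equiv.addRight e) g).symm

theorem inv_sum (g : ZMod p → ℤ) : ∑ x, g x⁻¹ = ∑ u, g u :=
  Equiv.sum_comp (Function.Involutive.toPerm (fun x : ZMod p => x⁻¹) inv_inv) g

theorem except_sum (g k : ZMod p → ℤ) (h : ∀ u, u ≠ 0 → g u = k u) :
    ∑ u, g u = ∑ u, k u - k 0 + g 0 := by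
  have : ∀ u, g u = k u + if u = 0 then g 0 - k 0 else 0 := by
    intro u
    by_cases hu : u = 0
    · simp [hu]
    · simp [hu, h u hu]
  rw [Finset.sum_congr rfl fun u _ => this u, Finset.sum_add_distrib]
  simp
  ring

theorem char_ne_two (h3 : 3 ≤ p) : ringChar (ZMod p) ≠ 2 := by
  rw [ZMod.ringChar_zmod_n]
  omega

theorem lin_sum (h3 : 3 ≤ p) (a : ZMod p) :
    ∑ x : ZMod p, quadraticChar (ZMod p) (x - a) = 0 := by
  rw [shift_sum _ a]
  simp only [add_sub_cancel_right]
  exact quadraticChar_sum_zero (char_ne_two h3)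

theorem quad_sum (h3 : 3 ≤ p) (a b : ZMod p) (hab : a ≠ b) :
    ∑ x : ZMod p, quadraticChar (ZMod p) (x - a) * quadraticChar (ZMod p) (x - b) = -1 := by
  rw [shift_sum _ b]
  have hd : b - a ≠ 0 := sub_ne_zero.2 hab.symm
  rw [except_sum _ (fun u => quadraticChar (ZMod p) (1 + (b - a) * u⁻¹))]
  · rw [inv_sum (fun u => quadraticChar (ZMod p) (1 + (b - a) * u))]
    have : ∑ u : ZMod p, quadraticChar (ZMod p) (1 + (b - a) * u) = 0 := by
      rw [← quadraticChar_sum_zero (char_ne_two h3)]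
      exact Equiv.sum_comp ((Equiv.mulLeft₀ (b - a) hd).trans (Equiv.addLeft 1))
        (fun y => quadraticChar (ZMod p) y)
    rw [this]
    simp
  · intro u hu
    have : (u + b - a) * (u + b - b) = (1 + (b - a) * u⁻¹) * (u * u) := by
      field_simp
      ring
    rw [← map_mul, this, map_mul, map_mul, chi_sq hu, mul_one]

theorem quart_sum (hbig : 3000 ≤ p) (a b c e : ZMod p) (ha : e ≠ a) (hb : e ≠ b) (hc : e ≠ c) :
    11 * |∑ x : ZMod p, quadraticChar (ZMod p) (x - a) * quadraticChar (ZMod p) (x - b) *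
      quadraticChar (ZMod p) (x - c) * quadraticChar (ZMod p) (x - e)| ≤ (p : ℤ) + 44 := by
  rw [shift_sum _ e]
  have ha' : e - a ≠ 0 := sub_ne_zero.2 ha
  have hb' : e - b ≠ 0 := sub_ne_zero.2 hb
  have hc' : e - c ≠ 0 := sub_ne_zero.2 hc
  rw [except_sum _ (fun u => quadraticChar (ZMod p)
    ((1 + (e - a) * u⁻¹) * (1 + (e - b) * u⁻¹) * (1 + (e - c) * u⁻¹)))]
  · rw [inv_sum (fun u => quadraticChar (ZMod p)
      ((1 + (e - a) * u) * (1 + (e - b) * u) * (1 + (e - c) * u)))]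
    have h1 : ∀ u : ZMod p, quadraticChar (ZMod p)
        ((1 + (e - a) * u) * (1 + (e - b) * u) * (1 + (e - c) * u)) =
        quadraticChar (ZMod p) ((e - a) * (e - b) * (e - c)) * quadraticChar (ZMod p)
        ((u - (-(e - a)⁻¹)) * (u - (-(e - b)⁻¹)) * (u - (-(e - c)⁻¹))) := by
      intro u
      rw [← map_mul]
      congr 1
      field_simp
      ring
    rw [Finset.sum_congr rfl fun u _ => h1 u, ← Finset.mul_sum]
    have h2 := cubic_sum hbig (-(e - a)⁻¹) (-(e - b)⁻¹) (-(e - c)⁻¹)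
    set S := ∑ u : ZMod p, quadraticChar (ZMod p)
      ((u - (-(e - a)⁻¹)) * (u - (-(e - b)⁻¹)) * (u - (-(e - c)⁻¹)))
    have h4 : quadraticChar (ZMod p) ((0 : ZMod p) + e - e) = 0 := by simp
    rw [h4, mul_zero, add_zero]
    have h5 : (1 + (e - a) * (0 : ZMod p)⁻¹) * (1 + (e - b) * (0 : ZMod p)⁻¹) *
        (1 + (e - c) * (0 : ZMod p)⁻¹) = 1 := by simp
    rw [h5, map_one]
    have h6 := abs_sub (quadraticChar (ZMod p) ((e - a) * (e - b) * (e - c)) * S) 1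
    rw [abs_mul] at h6
    have h7 := mul_le_mul_of_nonneg_right (chi_abs ((e - a) * (e - b) * (e - c))) (abs_nonneg S)
    rw [abs_one] at h6
    linarith
  · intro u hu
    have : (u + e - a) * (u + e - b) * (u + e - c) * (u + e - e) =
        ((1 + (e - a) * u⁻¹) * (1 + (e - b) * u⁻¹) * (1 + (e - c) * u⁻¹)) *
        ((u * u) * (u * u)) := by
      field_simp
      ring
    rw [← map_mul, ← map_mul, ← map_mul, this]
    simp only [map_mul, chi_sq hu, mul_one]

theorem cubic_sum' (hbig : 3000 ≤ p) (a b c : ZMod p) :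
    11 * |∑ x : ZMod p, quadraticChar (ZMod p) (x - a) * quadraticChar (ZMod p) (x - b) *
      quadraticChar (ZMod p) (x - c)| ≤ (p : ℤ) + 33 := by
  have := cubic_sum hbig a b c
  simpa only [map_mul] using this

theorem sq_sum (g : ZMod p → ℤ) :
    ∑ x : ZMod p, quadraticChar (ZMod p) (x - 0) * quadraticChar (ZMod p) (x - 0) * g x =
      ∑ x, g x - g 0 := by
  rw [except_sum _ g]
  · simp
  · intro u hu
    rw [sub_zero, chi_sq hu, one_mul]

theorem bad_card (L : List (ZMod p × ZMod p × ZMod p)) (hL : ∀ x ∈ L, x.1 ≠ 0 ∨ x.2.1 ≠ 0) :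
    (Finset.univ.filter fun t : ZMod p =>
      ∃ x ∈ L, x.1 * t ^ 2 + x.2.1 * t + x.2.2 = 0).card ≤ 2 * L.length := by
  induction L with
  | nil => simp
  | cons x L ih =>
    have ih' := ih fun y hy => hL y (List.mem_cons_of_mem _ hy)
    have hx := hL x List.mem_cons_self
    have h1 : (Finset.univ.filter fun t : ZMod p =>
        x.1 * t ^ 2 + x.2.1 * t + x.2.2 = 0).card ≤ 2 := by
      open Polynomial in
      set P : (ZMod p)[X] := C x.1 * X ^ 2 + C x.2.1 * X + C x.2.2 with hP
      have hP0 : P ≠ 0 := by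
        intro h
        rcases hx with hx | hx
        · have := congrArg (fun Q => Polynomial.coeff Q 2) h
          simp [hP, Polynomial.coeff_X, Polynomial.coeff_C] at this
          exact hx this
        · have := congrArg (fun Q => Polynomial.coeff Q 1) h
          simp [hP, Polynomial.coeff_X, Polynomial.coeff_C] at this
          exact hx this
      have hdeg : P.natDegree ≤ 2 := Polynomial.natDegree_quadratic_le
      refine le_trans ?_ hdeg
      refine le_trans (Finset.card_le_card (t := P.roots.toFinset) ?_)
        ((Multiset.toFinset_card_le _).trans (Polynomial.card_roots' P))
      intro t ht
      rw [Multiset.mem_toFinset, Polynomial.mem_roots hP0]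
      simpa [hP] using (Finset.mem_filter.1 ht).2
    refine le_trans (Finset.card_le_card (t := (Finset.univ.filter fun t : ZMod p =>
        x.1 * t ^ 2 + x.2.1 * t + x.2.2 = 0) ∪ (Finset.univ.filter fun t : ZMod p =>
      ∃ x ∈ L, x.1 * t ^ 2 + x.2.1 * t + x.2.2 = 0)) ?_) ((Finset.card_union_le _ _).trans ?_)
    · intro t ht
      simpa using ht
    · rw [List.length_cons]; omega

theorem main_sum (hbig : 3000 ≤ p) (a b c d : ZMod p) (s : ℤ) (hs : s = 1 ∨ s = -1)
    (hab : a ≠ b) (h0a : 0 ≠ a) (h0b : 0 ≠ b) (h0c : 0 ≠ c) (h0d : 0 ≠ d) (hca : c ≠ a)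
    (hcb : c ≠ b) (hcd : c ≠ d) :
    2 * (p : ℤ) - 418 ≤ 11 * ∑ x : ZMod p,
      (1 - s * quadraticChar (ZMod p) (x - a)) * (1 + s * quadraticChar (ZMod p) (x - b)) *
      (1 - quadraticChar (ZMod p) (x - 0) * quadraticChar (ZMod p) (x - c)) *
      (1 + quadraticChar (ZMod p) (x - 0) * quadraticChar (ZMod p) (x - d)) := by
  have h3 : 3 ≤ p := by omega
  set P : ZMod p → ℤ := fun x => quadraticChar (ZMod p) (x - a) with hP
  set Q : ZMod p → ℤ := fun x => quadraticChar (ZMod p) (x - b) with hQ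
  set R : ZMod p → ℤ := fun x => quadraticChar (ZMod p) (x - 0) with hR
  set U : ZMod p → ℤ := fun x => quadraticChar (ZMod p) (x - c) with hU
  set W : ZMod p → ℤ := fun x => quadraticChar (ZMod p) (x - d) with hW
  have hss : s * s = 1 := by rcases hs with rfl | rfl <;> norm_num
  have expand : ∀ x, (1 - s * P x) * (1 + s * Q x) * (1 - R x * U x) * (1 + R x * W x) =
      1 - s * P x + s * Q x - P x * Q x - R x * U x + R x * W x
      + s * (P x * U x * R x) - s * (P x * W x * R x)
      - s * (Q x * U x * R x) + s * (Q x * W x * R x)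
      - R x * R x * (U x * W x)
      + P x * Q x * U x * R x - P x * Q x * W x * R x
      + s * (R x * R x * (P x * U x * W x)) - s * (R x * R x * (Q x * U x * W x))
      + R x * R x * (P x * Q x * W x * U x) := by
    intro x
    linear_combination (-(P x * Q x) * (1 - R x * U x) * (1 + R x * W x)) * hss
  have l1 : ∑ x, P x = 0 := lin_sum h3 a
  have l2 : ∑ x, Q x = 0 := lin_sum h3 b
  have q1 : ∑ x, P x * Q x = -1 := quad_sum h3 a b hab
  have q2 : ∑ x, R x * U x = -1 := quad_sum h3 0 c h0c
  have q3 : ∑ x, R x * W x = -1 := quad_sum h3 0 d h0d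
  have q4 : ∑ x, U x * W x = -1 := quad_sum h3 c d hcd
  have c1 : 11 * |∑ x, P x * U x * R x| ≤ (p : ℤ) + 33 := cubic_sum' hbig a c 0
  have c2 : 11 * |∑ x, P x * W x * R x| ≤ (p : ℤ) + 33 := cubic_sum' hbig a d 0
  have c3 : 11 * |∑ x, Q x * U x * R x| ≤ (p : ℤ) + 33 := cubic_sum' hbig b c 0
  have c4 : 11 * |∑ x, Q x * W x * R x| ≤ (p : ℤ) + 33 := cubic_sum' hbig b d 0
  have c5 : 11 * |∑ x, P x * U x * W x| ≤ (p : ℤ) + 33 := cubic_sum' hbig a c d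
  have c6 : 11 * |∑ x, Q x * U x * W x| ≤ (p : ℤ) + 33 := cubic_sum' hbig b c d
  have d1 : 11 * |∑ x, P x * Q x * U x * R x| ≤ (p : ℤ) + 44 := quart_sum hbig a b c 0 h0a h0b h0c
  have d2 : 11 * |∑ x, P x * Q x * W x * R x| ≤ (p : ℤ) + 44 := quart_sum hbig a b d 0 h0a h0b h0d
  have d3 : 11 * |∑ x, P x * Q x * W x * U x| ≤ (p : ℤ) + 44 := quart_sum hbig a b d c hca hcb hcd
  have e1 : ∑ x, R x * R x * (U x * W x) = ∑ x, U x * W x - U 0 * W 0 := sq_sum _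
  have e2 : ∑ x, R x * R x * (P x * U x * W x) = ∑ x, P x * U x * W x - P 0 * U 0 * W 0 :=
    sq_sum _
  have e3 : ∑ x, R x * R x * (Q x * U x * W x) = ∑ x, Q x * U x * W x - Q 0 * U 0 * W 0 :=
    sq_sum _
  have e4 : ∑ x, R x * R x * (P x * Q x * W x * U x) =
    ∑ x, P x * Q x * W x * U x - P 0 * Q 0 * W 0 * U 0 := sq_sum _
  have f1 : |U 0 * W 0| ≤ 1 := by
    have := chi_abs ((0 - c) * (0 - d)); rwa [map_mul] at this
  have f2 : |P 0 * U 0 * W 0| ≤ 1 := by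
    have := chi_abs ((0 - a) * (0 - c) * (0 - d)); rwa [map_mul, map_mul] at this
  have f3 : |Q 0 * U 0 * W 0| ≤ 1 := by
    have := chi_abs ((0 - b) * (0 - c) * (0 - d)); rwa [map_mul, map_mul] at this
  have f4 : |P 0 * Q 0 * W 0 * U 0| ≤ 1 := by
    have := chi_abs ((0 - a) * (0 - b) * (0 - d) * (0 - c))
    rwa [map_mul, map_mul, map_mul] at this
  have hone : ∑ x : ZMod p, (1 : ℤ) = p := by simp [ZMod.card]
  change _ ≤ 11 * ∑ x, (1 - s * P x) * (1 + s * Q x) * (1 - R x * U x) * (1 + R x * W x)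
  rw [Finset.sum_congr rfl fun x _ => expand x]
  simp only [Finset.sum_add_distrib, Finset.sum_sub_distrib, ← Finset.mul_sum]
  rw [hone, l1, l2, q1, q2, q3, e1, e2, e3, e4, q4]
  have key : ∀ {n m : ℤ}, 11 * |n| ≤ m → 11 * n ≤ m ∧ -m ≤ 11 * n := by
    intro n m h
    constructor
    · linarith [le_abs_self n]
    · linarith [neg_abs_le n]
  obtain ⟨c1, c1'⟩ := key c1
  obtain ⟨c2, c2'⟩ := key c2
  obtain ⟨c3, c3'⟩ := key c3
  obtain ⟨c4, c4'⟩ := key c4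
  obtain ⟨c5, c5'⟩ := key c5
  obtain ⟨c6, c6'⟩ := key c6
  obtain ⟨d1, d1'⟩ := key d1
  obtain ⟨d2, d2'⟩ := key d2
  obtain ⟨d3, d3'⟩ := key d3
  obtain ⟨f1, f1'⟩ := abs_le.1 f1
  obtain ⟨f2, f2'⟩ := abs_le.1 f2
  obtain ⟨f3, f3'⟩ := abs_le.1 f3
  obtain ⟨f4, f4'⟩ := abs_le.1 f4
  rcases hs with rfl | rfl <;> linarith

end

end Step

namespace Step

section
variable {p : ℕ} [Fact p.Prime]

/-- Coefficients of the polynomials whose zeros have to be avoided. -/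
def badList (p : ℕ) : List (ZMod p × ZMod p × ZMod p) :=
  [(0, 1, 0), (0, 1, -1), (0, 1, -3), (0, 1, -9), (0, 3, -1), (0, 5, 3), (0, 3, -4), (0, 1, 2),
    (0, 2, 3), (0, 4, -9), (0, 1, 5), (1, -11, 12), (4, -11, 3), (1, -8, 3), (0, 9, -1),
    (0, 1, -27)]

theorem hasAPD_big (hbig : 3100 ≤ p) : HasAPD (ZMod p) := by
  have n2 : (2 : ZMod p) ≠ 0 := by exact_mod_cast nat_ne 2 (by omega) (by omega)
  have n3 : (3 : ZMod p) ≠ 0 := by exact_mod_cast nat_ne 3 (by omega) (by omega)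
  have n4 : (4 : ZMod p) ≠ 0 := by exact_mod_cast nat_ne 4 (by omega) (by omega)
  have n5 : (5 : ZMod p) ≠ 0 := by exact_mod_cast nat_ne 5 (by omega) (by omega)
  have n7 : (7 : ZMod p) ≠ 0 := by exact_mod_cast nat_ne 7 (by omega) (by omega)
  have n8 : (8 : ZMod p) ≠ 0 := by exact_mod_cast nat_ne 8 (by omega) (by omega)
  have n9 : (9 : ZMod p) ≠ 0 := by exact_mod_cast nat_ne 9 (by omega) (by omega)
  have n24 : (24 : ZMod p) ≠ 0 := by exact_mod_cast nat_ne 24 (by omega) (by omega)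
  have n26 : (26 : ZMod p) ≠ 0 := by exact_mod_cast nat_ne 26 (by omega) (by omega)
  have n27 : (27 : ZMod p) ≠ 0 := by exact_mod_cast nat_ne 27 (by omega) (by omega)
  have i9 : (9 : ZMod p) * 9⁻¹ = 1 := mul_inv_cancel₀ n9
  set s : ℤ := quadraticChar (ZMod p) (-1) with hs
  have hs1 : s = 1 ∨ s = -1 := quadraticChar_dichotomy (neg_ne_zero.2 one_ne_zero)
  have hsum := main_sum (by omega : 3000 ≤ p) (1 : ZMod p) 9⁻¹ 3 27 s hs1
    (by intro h; exact n8 (by linear_combination 9 * h + i9))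
    zero_ne_one (inv_ne_zero n9).symm n3.symm n27.symm
    (by intro h; exact n2 (by linear_combination h))
    (by intro h; exact n26 (by linear_combination 9 * h + i9))
    (by intro h; exact n24 (by linear_combination -h))
  set g : ZMod p → ℤ := fun x =>
      (1 - s * quadraticChar (ZMod p) (x - 1)) * (1 + s * quadraticChar (ZMod p) (x - 9⁻¹)) *
      (1 - quadraticChar (ZMod p) (x - 0) * quadraticChar (ZMod p) (x - 3)) *
      (1 + quadraticChar (ZMod p) (x - 0) * quadraticChar (ZMod p) (x - 27)) with hg
  have hA : ∀ t : ZMod p, s * quadraticChar (ZMod p) (t - 1) = quadraticChar (ZMod p) (1 - t) := by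
    intro t
    rw [hs, ← map_mul]; congr 1; ring
  have hB : ∀ t : ZMod p, s * quadraticChar (ZMod p) (t - 9⁻¹) =
      quadraticChar (ZMod p) (1 - 9 * t) := by
    intro t
    have : (1 - 9 * t : ZMod p) = (-1) * (t - 9⁻¹) * (3 * 3) := by linear_combination -i9
    rw [this]
    simp only [map_mul, chi_sq n3, mul_one]
    rfl
  have hgle : ∀ x, g x ≤ 16 := by
    intro x
    have tri : ∀ y : ZMod p, quadraticChar (ZMod p) y = 0 ∨ quadraticChar (ZMod p) y = 1 ∨
        quadraticChar (ZMod p) y = -1 := by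
      intro y
      by_cases hy : y = 0
      · left; rw [hy, quadraticChar_zero]
      · right; exact quadraticChar_dichotomy hy
    simp only [hg, hA, hB, ← map_mul]
    rcases tri (1 - x) with h1 | h1 | h1 <;> rcases tri (1 - 9 * x) with h2 | h2 | h2 <;>
    rcases tri ((x - 0) * (x - 3)) with h3 | h3 | h3 <;>
    rcases tri ((x - 0) * (x - 27)) with h4 | h4 | h4 <;> rw [h1, h2, h3, h4] <;> norm_num
  have hcard := bad_card (badList p) (by
    intro x hx
    simp only [badList, List.mem_cons, List.not_mem_nil, or_false] at hx
    rcases hx with rfl | rfl | rfl | rfl | rfl | rfl | rfl | rfl | rfl | rfl | rfl | rfl | rfl |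
      rfl | rfl | rfl <;> simp [n2, n3, n4, n5, n9])
  set E := (Finset.univ.filter fun t : ZMod p =>
      ∃ x ∈ badList p, x.1 * t ^ 2 + x.2.1 * t + x.2.2 = 0) with hE
  obtain ⟨t, htE, htpos⟩ : ∃ t, t ∉ E ∧ 0 < g t := by
    by_contra! hc
    have h1 : ∑ x, g x ≤ ∑ x : ZMod p, if x ∈ E then (16 : ℤ) else 0 := by
      refine Finset.sum_le_sum fun x _ => ?_
      split_ifs with h
      · exact hgle x
      · exact hc x h
    rw [← Finset.sum_filter, Finset.sum_const, nsmul_eq_mul] at h1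
    have h2 : (Finset.univ.filter fun x => x ∈ E) = E := by ext; simp
    rw [h2] at h1
    have h3 : (badList p).length = 16 := rfl
    rw [h3] at hcard
    have h4 : (E.card : ℤ) ≤ 32 := by exact_mod_cast hcard
    have h5 : (3100 : ℤ) ≤ p := by exact_mod_cast hbig
    linarith
  have hbad : ∀ a b c : ZMod p, (a, b, c) ∈ badList p → a * t ^ 2 + b * t + c ≠ 0 := by
    intro a b c hmem h0
    apply htE
    rw [hE, Finset.mem_filter]
    exact ⟨Finset.mem_univ _, (a, b, c), hmem, h0⟩
  have b0 := hbad 0 1 0 (by simp [badList])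
  have b1 := hbad 0 1 (-1) (by simp [badList])
  have b2 := hbad 0 1 (-3) (by simp [badList])
  have b3 := hbad 0 1 (-9) (by simp [badList])
  have b4 := hbad 0 3 (-1) (by simp [badList])
  have b5 := hbad 0 5 3 (by simp [badList])
  have b6 := hbad 0 3 (-4) (by simp [badList])
  have b7 := hbad 0 1 2 (by simp [badList])
  have b8 := hbad 0 2 3 (by simp [badList])
  have b9 := hbad 0 4 (-9) (by simp [badList])
  have b10 := hbad 0 1 5 (by simp [badList])
  have b11 := hbad 1 (-11) 12 (by simp [badList])
  have b12 := hbad 4 (-11) 3 (by simp [badList])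
  have b13 := hbad 1 (-8) 3 (by simp [badList])
  have b14 := hbad 0 9 (-1) (by simp [badList])
  have b15 := hbad 0 1 (-27) (by simp [badList])
  have t0 : t ≠ 0 := fun h => b0 (by linear_combination h)
  have t1 : 1 - t ≠ 0 := fun h => b1 (by linear_combination -h)
  have t3 : t - 3 ≠ 0 := fun h => b2 (by linear_combination h)
  have t27 : t - 27 ≠ 0 := fun h => b15 (by linear_combination h)
  have t9 : 1 - 9 * t ≠ 0 := fun h => b14 (by linear_combination -h)
  have nondeg : APD.Nondeg t :=
    { c2 := n2
      c3 := n3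
      c5 := n5
      c7 := n7
      t0 := t0
      t1 := fun h => b1 (by linear_combination h)
      t3 := t3
      t9 := fun h => b3 (by linear_combination h)
      a1 := fun h => b4 (by linear_combination h)
      a2 := fun h => b5 (by linear_combination h)
      a3 := fun h => b6 (by linear_combination h)
      a4 := fun h => b7 (by linear_combination h)
      a5 := fun h => b8 (by linear_combination h)
      a6 := fun h => b9 (by linear_combination h)
      a7 := fun h => b10 (by linear_combination h)
      q1 := fun h => b11 (by linear_combination h)
      q2 := fun h => b12 (by linear_combination h)
      q3 := fun h => b13 (by linear_combination h) }
  simp only [hg, hA, hB, sub_zero] at htpos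
  have d1 := quadraticChar_dichotomy t1
  have d2 := quadraticChar_dichotomy t9
  have d3 := quadraticChar_dichotomy t0
  have d4 := quadraticChar_dichotomy t3
  have d5 := quadraticChar_dichotomy t27
  have hfin : quadraticChar (ZMod p) (1 - t) = -1 ∧ quadraticChar (ZMod p) (1 - 9 * t) = 1 ∧
      quadraticChar (ZMod p) t * quadraticChar (ZMod p) (t - 3) = -1 ∧
      quadraticChar (ZMod p) (t - 3) * quadraticChar (ZMod p) (t - 27) = -1 := by
    rcases d1 with d1 | d1 <;> rcases d2 with d2 | d2 <;> rcases d3 with d3 | d3 <;>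
    rcases d4 with d4 | d4 <;> rcases d5 with d5 | d5 <;> revert htpos <;>
    rw [d1, d2, d3, d4, d5] <;> norm_num
  obtain ⟨f1, f2, f3, f4⟩ := hfin
  refine APD.hasAPD_of_param nondeg ?_ ?_ ?_ ?_
  · exact quadraticChar_neg_one_iff_not_isSquare.1 f1
  · exact quadraticChar_neg_one_iff_not_isSquare.1 (by rw [map_mul, f3])
  · exact quadraticChar_neg_one_iff_not_isSquare.1 (by rw [map_mul, f1, f2]; rfl)
  · exact quadraticChar_neg_one_iff_not_isSquare.1 (by rw [map_mul, f4])

end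

end Step

namespace Small

/-- Entries of a table of small numbers. -/
def tab (T i : ℕ) : ℕ := T / 128 ^ i % 128

/-- The table describes an injective map destroying progressions. -/
def tableOK (n T : ℕ) : Bool :=
  (List.range n).all fun x =>
    ((List.range n).all fun y => decide (x = y ∨ tab T x % n ≠ tab T y % n)) &&
    ((List.range n).all fun d =>
      decide (d = 0 ∨ (tab T ((x + (n - d)) % n) + tab T ((x + d) % n)) % n ≠
        (tab T x + tab T x) % n))

theorem hasAPD_of_table (n T : ℕ) [NeZero n] (h : tableOK n T = true) : HasAPD (ZMod n) := by
  simp only [tableOK, List.all_eq_true, List.mem_range, Bool.and_eq_true, decide_eq_true_eq] at h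
  refine ⟨fun x => (tab T x.val : ZMod n), ?_, ?_⟩
  · intro x y hxy
    have := (h x.val (ZMod.val_lt x)).1 y.val (ZMod.val_lt y)
    rcases this with e | e
    · exact ZMod.val_injective n e
    · exact absurd ((ZMod.natCast_eq_natCast_iff' _ _ _).1 hxy) e
  · intro x d hd hxy
    have h1 : (x - d).val = (x.val + (n - d.val)) % n := by
      rw [← ZMod.val_natCast]
      congr 1
      rw [Nat.cast_add, Nat.cast_sub (ZMod.val_lt d).le]
      simp [sub_eq_add_neg]
    have h2 : (x + d).val = (x.val + d.val) % n := ZMod.val_add x d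
    rcases (h x.val (ZMod.val_lt x)).2 d.val (ZMod.val_lt d) with e | e
    · exact hd ((ZMod.val_eq_zero d).1 e)
    · apply e
      rw [← h1, ← h2]
      apply (ZMod.natCast_eq_natCast_iff' _ _ _).1
      push_cast
      exact hxy

theorem hasAPD_11 : HasAPD (ZMod 11) :=
  hasAPD_of_table 11 8273582033643788993541 (by decide +kernel)

theorem hasAPD_17 : HasAPD (ZMod 17) :=
  hasAPD_of_table 17 62636210914357310861209258694951306 (by decide +kernel)

theorem hasAPD_23 : HasAPD (ZMod 23) :=
  hasAPD_of_table 23 276714682103019874311556091181433924056238082830 (by decide +kernel)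

theorem hasAPD_31 : HasAPD (ZMod 31) :=
  hasAPD_of_table 31 43156646943717067484877711364028839652659079888374161645114900758 (by decide +kernel)

theorem hasAPD_37 : HasAPD (ZMod 37) :=
  hasAPD_of_table 37 94934521918500507778937120223001846890127702449542110837960846634015640764547 (by decide +kernel)

theorem hasAPD_53 : HasAPD (ZMod 53) :=
  hasAPD_of_table 53 2456971339260880953411746287571967900763551439672812658829468494544398796393318796406430091427051946905931785 (by decide +kernel)

theorem hasAPD_61 : HasAPD (ZMod 61) :=
  hasAPD_of_table 61 76070025851191102302239549004729815366159599279286529813518268182047560174209980167298711752427356864245084755223469023566630021 (by decide +kernel)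

theorem hasAPD_83 : HasAPD (ZMod 83) :=
  hasAPD_of_table 83 1880201507168571737350485049345638257541178723518613579402628155917592773320802577059968491733238334932376304340400710449520690701054254893159526067259489656617624397594761542 (by decide +kernel)

/-- Quantities that must be nonzero; here `m` stands for `-1`. -/
def nzList (m t : ℕ) : List ℕ :=
  [2, 3, 5, 7, t, t + m, t + 3 * m, t + 9 * m, 3 * t + m, 5 * t + 3, 3 * t + 4 * m, t + 2,
    2 * t + 3, 4 * t + 9 * m, t + 5, t ^ 2 + 11 * m * t + 12, 4 * t ^ 2 + 11 * m * t + 3,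
    t ^ 2 + 8 * m * t + 3]

/-- Quantities that must be nonsquares; here `m` stands for `-1`. -/
def nsList (m t : ℕ) : List ℕ :=
  [1 + m * t, t * (t + 3 * m), (1 + m * t) * (1 + 9 * m * t), (t + 3 * m) * (t + 27 * m)]

/-- The parameter `t` is admissible modulo `p`. -/
def good (p t : ℕ) : Bool :=
  ((nsList (p - 1) t).all fun a => decide ((a % p) ^ (p / 2) % p = p - 1)) &&
  ((nzList (p - 1) t).all fun a => decide (a % p ≠ 0))

/-- Primes handled by tables. -/
def exc : List ℕ := [11, 17, 23, 31, 37, 53, 61, 83]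

/-- Trial divisors. -/
def divisors : List ℕ := [2, 3, 5, 7, 11, 13, 17, 19, 23, 29, 31, 37, 41, 43, 47, 53]

/-- Everything that has to be verified for the number `p`. -/
def pOK (p : ℕ) : Bool :=
  (divisors.any fun q => decide (q < p ∧ p % q = 0)) ||
  (exc.any fun q => decide (p = q)) ||
  ((List.range 120).any fun t => good p t)

theorem all_pOK :
    ((List.range 56).all fun i => (List.range 56).all fun j => pOK (i * 56 + j + 11)) = true := by
  decide +kernel

theorem hasAPD_of_good (p t : ℕ) [Fact p.Prime] (h2 : 3 ≤ p) (h : good p t = true) :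
    HasAPD (ZMod p) := by
  simp only [good, Bool.and_eq_true, List.all_eq_true, decide_eq_true_eq] at h
  obtain ⟨hs, hz⟩ := h
  have hm : ((p - 1 : ℕ) : ZMod p) = -1 := by
    rw [Nat.cast_sub (by omega)]
    simp
  have two : (2 : ZMod p) ≠ 0 := by exact_mod_cast Step.nat_ne 2 (by omega) (by omega)
  have ns : ∀ a ∈ nsList (p - 1) t, ¬ IsSquare (a : ZMod p) := by
    rintro a ha ⟨y, hy⟩
    have h1 : ((a : ZMod p)) ^ (p / 2) = -1 := by
      have := hs a ha
      rw [← hm, ← Nat.cast_pow, ZMod.natCast_eq_natCast_iff', Nat.pow_mod, this]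
      exact (Nat.mod_eq_of_lt (by omega)).symm
    have hp2 : p / 2 + p / 2 = p - 1 := by
      have hpp : p.Prime := Fact.out
      rcases hpp.eq_two_or_odd with h | h <;> omega
    rw [hy, mul_pow, ← pow_add, hp2] at h1
    by_cases hy0 : y = 0
    · rw [hy0, zero_pow (by omega)] at h1
      exact one_ne_zero (α := ZMod p) (by linear_combination h1)
    · rw [ZMod.pow_card_sub_one_eq_one hy0] at h1
      exact two (by linear_combination h1)
  have nz : ∀ a ∈ nzList (p - 1) t, (a : ZMod p) ≠ 0 := by
    intro a ha h0
    rw [ZMod.natCast_eq_zero_iff] at h0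
    exact hz a ha (Nat.mod_eq_zero_of_dvd h0)
  simp only [nsList, nzList, List.forall_mem_cons, Nat.cast_add, Nat.cast_mul, Nat.cast_pow, hm,
    Nat.cast_ofNat, Nat.cast_one] at ns nz
  obtain ⟨s1, s2, s3, s4, -⟩ := ns
  obtain ⟨z1, z2, z3, z4, z5, z6, z7, z8, z9, z10, z11, z12, z13, z14, z15, z16, z17, z18, -⟩ := nz
  refine APD.hasAPD_of_param (t := (t : ZMod p)) ⟨z1, z2, z3, z4, z5, ?_, ?_, ?_, ?_, z10, ?_, z12,
    z13, ?_, z15, ?_, ?_, ?_⟩ ?_ ?_ ?_ ?_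
  · exact fun h => z6 (by linear_combination h)
  · exact fun h => z7 (by linear_combination h)
  · exact fun h => z8 (by linear_combination h)
  · exact fun h => z9 (by linear_combination h)
  · exact fun h => z11 (by linear_combination h)
  · exact fun h => z14 (by linear_combination h)
  · exact fun h => z16 (by linear_combination h)
  · exact fun h => z17 (by linear_combination h)
  · exact fun h => z18 (by linear_combination h)
  · convert s1 using 2; ring
  · convert s2 using 2; ring
  · convert s3 using 2; ring
  · convert s4 using 2; ring

theorem hasAPD_small (p : ℕ) [Fact p.Prime] (h1 : 11 ≤ p) (h2 : p < 3100) :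
    HasAPD (ZMod p) := by
  have hpp : p.Prime := Fact.out
  have h := List.all_eq_true.1 (List.all_eq_true.1 all_pOK ((p - 11) / 56)
    (List.mem_range.2 (by omega))) ((p - 11) % 56) (List.mem_range.2 (by omega))
  have hpe : (p - 11) / 56 * 56 + (p - 11) % 56 + 11 = p := by omega
  rw [hpe] at h
  simp only [pOK, Bool.or_eq_true, List.any_eq_true, decide_eq_true_eq] at h
  rcases h with (⟨q, hq, hlt, hmod⟩ | ⟨q, hq, rfl⟩) | ⟨t, -, ht⟩
  · exfalso
    have hq2 : 2 ≤ q := by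
      simp only [divisors, List.mem_cons, List.not_mem_nil, or_false] at hq
      omega
    rcases (Nat.dvd_prime hpp).1 (Nat.dvd_of_mod_eq_zero hmod) with h | h <;> omega
  · simp only [exc, List.mem_cons, List.not_mem_nil, or_false] at hq
    rcases hq with rfl | rfl | rfl | rfl | rfl | rfl | rfl | rfl
    · exact hasAPD_11
    · exact hasAPD_17
    · exact hasAPD_23
    · exact hasAPD_31
    · exact hasAPD_37
    · exact hasAPD_53
    · exact hasAPD_61
    · exact hasAPD_83
  · exact hasAPD_of_good p t (by omega) ht

theorem hasAPD_prime (p : ℕ) [Fact p.Prime] (h1 : 11 ≤ p) : HasAPD (ZMod p) := by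
  rcases lt_or_ge p 3100 with h | h
  · exact hasAPD_small p h1 h
  · exact Step.hasAPD_big h

end Small

/-- A permutation `π` of an abelian group `G` is AP-destroying if there is no
ordered triple `(a,b,c)` with `b - a = c - b ≠ 0` and `π b - π a = π c - π b`. -/
theorem ap_destroying_perm_of_elementary_p_group_iff
    (p k : ℕ) (hp : p.Prime) (hk : 0 < k) :
    (∃ π : Equiv.Perm (Fin k → ZMod p),
        ∀ a b c : Fin k → ZMod p, b - a = c - b → b - a ≠ 0 →
          π b - π a ≠ π c - π b) ↔
      Odd p ∧ (p, k) ∉ ({(3, 1), (5, 1), (7, 1)} : Set (ℕ × ℕ)) := by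
  have : Fact p.Prime := ⟨hp⟩
  rw [← hasAPD_iff]
  constructor
  · intro h
    refine ⟨?_, ?_⟩
    · rcases hp.eq_two_or_odd' with rfl | h'
      · exact absurd h (not_hasAPD_two k hk)
      · exact h'
    · intro hmem
      simp only [Set.mem_insert_iff, Set.mem_singleton_iff, Prod.mk.injEq] at hmem
      rcases hmem with ⟨rfl, rfl⟩ | ⟨rfl, rfl⟩ | ⟨rfl, rfl⟩
      · exact not_hasAPD_z3 ((hasAPD_one_iff 3).1 h)
      · exact not_hasAPD_z5 ((hasAPD_one_iff 5).1 h)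
      · exact not_hasAPD_z7 ((hasAPD_one_iff 7).1 h)
  · rintro ⟨hodd, hmem⟩
    have hp2 : p ≠ 2 := by
      rintro rfl
      revert hodd
      decide
    have hp3 : 3 ≤ p := by
      have := hp.two_le
      omega
    rcases Nat.lt_or_ge k 2 with hk2 | hk2
    · obtain rfl : k = 1 := by omega
      rw [hasAPD_one_iff]
      apply Small.hasAPD_prime
      simp only [Set.mem_insert_iff, Set.mem_singleton_iff, Prod.mk.injEq, and_true] at hmem
      by_contra! hlt
      have h9 : p ≠ 9 := by
        rintro rfl
        revert hp
        norm_num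
      rcases hodd with ⟨r, hr⟩
      omega
    · refine hasAPD_ge_two (ZMod p) ?_ k hk2
      exact_mod_cast Step.nat_ne 2 (by omega) (by omega)
end

section
/- Let F_q be a finite field of odd order q, let χ be the quadratic character on F_q, and let g ∈ F_q[x] be a polynomial of degree 3 or 4 such that g is not of the form c·h² for any c ∈ F_q and h ∈ F_q[x]. Then |χ(a) + ∑_{y ∈ F_q} χ(g(y))| ≤ 2√q, where a is the coefficient of x⁴ in g. -/
section

open Polynomial

theorem HB.xrel {K : Type*} [Field K] [DecidableEq K] (h2 : (2 : K) ≠ 0)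
    (W : WeierstrassCurve.Affine K) (ha1 : W.a₁ = 0) (ha3 : W.a₃ = 0)
    (P : W.Point) (x y : K) (h : W.Nonsingular x y) (hy : y ≠ 0) :
    ∃ k : K, k ≠ 0 ∧
      k * ((P + .some x y h).xRep 1 * (P - .some x y h).xRep 1) =
        (P.xRep 0 - x * P.xRep 1) ^ 2 ∧
      k * ((P + .some x y h).xRep 0 * (P - .some x y h).xRep 1 +
        (P + .some x y h).xRep 1 * (P - .some x y h).xRep 0) =
        2 * ((P.xRep 0 + x * P.xRep 1) * (P.xRep 0 * x + W.a₄ * P.xRep 1)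
          + 2 * W.a₂ * P.xRep 0 * P.xRep 1 * x + 2 * W.a₆ * P.xRep 1 ^ 2) ∧
      k * ((P + .some x y h).xRep 0 * (P - .some x y h).xRep 0) =
        (P.xRep 0 * x - W.a₄ * P.xRep 1) ^ 2
          - 4 * W.a₆ * P.xRep 1 * (P.xRep 0 + x * P.xRep 1 + W.a₂ * P.xRep 1) := by
  have h2y : 2 * y ≠ 0 := mul_ne_zero h2 hy
  have h4 : 4 * y ^ 2 ≠ 0 := by
    rw [show 4 * y ^ 2 = (2 * y) ^ 2 by ring]; exact pow_ne_zero _ h2y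
  have hyy : y ≠ -y := fun e => h2y (by linear_combination e)
  have hneg : ∀ x y, W.negY x y = - y := by
    intro x y; simp [WeierstrassCurve.Affine.negY, ha1, ha3]
  have heq := (WeierstrassCurve.Affine.equation_iff _ _).1 h.1
  simp only [ha1, ha3, zero_mul, add_zero] at heq
  have hdbl : ∀ (z : K) (hz : z ≠ 0) (hh : W.Nonsingular x z),
      ((WeierstrassCurve.Affine.Point.some x z hh) + .some x z hh).xRep =
      ![((3 * x ^ 2 + 2 * W.a₂ * x + W.a₄) / (2 * z)) ^ 2 - W.a₂ - 2 * x, 1] := by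
    intro z hz hh
    have hzz : z ≠ W.negY x z := by
      rw [hneg]; exact fun e => mul_ne_zero h2 hz (by linear_combination e)
    rw [WeierstrassCurve.Affine.Point.add_self_of_Y_ne hzz]
    rw [WeierstrassCurve.Affine.Point.xRep_some, WeierstrassCurve.Affine.slope_of_Y_ne rfl hzz]
    simp only [WeierstrassCurve.Affine.addX, hneg, ha1]
    rw [show z - -z = 2 * z by ring]
    congr 1
    ring
  rcases P with _ | ⟨x₁, y₁, h₁⟩
  · rw [← WeierstrassCurve.Affine.Point.zero_def]
    refine ⟨1, one_ne_zero, ?_⟩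
    simp
    try refine ⟨by ring, by ring⟩
  · have heq₁ := (WeierstrassCurve.Affine.equation_iff _ _).1 h₁.1
    simp only [ha1, ha3, zero_mul, add_zero] at heq₁
    rw [sub_eq_add_neg, WeierstrassCurve.Affine.Point.neg_some]
    by_cases hx : x₁ = x
    · subst hx
      have : y₁ = y ∨ y₁ = - y := by
        have : (y₁ - y) * (y₁ + y) = 0 := by linear_combination heq₁ - heq
        rcases mul_eq_zero.1 this with h | h
        · left; linear_combination h
        · right; linear_combination h
      rcases this with rfl | rfl
      · rw [WeierstrassCurve.Affine.Point.add_of_Y_eq (y₂ := WeierstrassCurve.Affine.negY _ _ _) rfl (by simp [ha1, ha3])]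
        rw [hdbl y₁ hy]
        refine ⟨4 * y₁ ^ 2, h4, ?_⟩
        simp
        constructor
        · linear_combination 4 * heq
        · field_simp
          linear_combination (-16 * W.a₂ - 32 * x₁) * heq
      · rw [WeierstrassCurve.Affine.Point.add_of_Y_eq (y₁ := - y) (y₂ := y) rfl (by simp [ha1, ha3])]
        have : WeierstrassCurve.Affine.Point.some x₁ _ ((WeierstrassCurve.Affine.nonsingular_neg x₁ y).2 h) = WeierstrassCurve.Affine.Point.some x₁ (-y) h₁ := by
          simp [ha1, ha3]
        rw [this, hdbl (-y) (neg_ne_zero.2 hy)]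
        refine ⟨4 * y ^ 2, h4, ?_⟩
        simp
        constructor
        · linear_combination 4 * heq
        · field_simp
          linear_combination (-16 * W.a₂ - 32 * x₁) * heq
    · rw [WeierstrassCurve.Affine.Point.add_of_X_ne hx, WeierstrassCurve.Affine.Point.add_of_X_ne hx]
      have hx' : x₁ - x ≠ 0 := sub_ne_zero.2 hx
      refine ⟨(x₁ - x) ^ 2, pow_ne_zero _ hx', ?_⟩
      simp [WeierstrassCurve.Affine.slope_of_X_ne hx, WeierstrassCurve.Affine.addX, ha1, ha3]
      have e1 : W.a₆ = y ^ 2 - (x ^ 3 + W.a₂ * x ^ 2 + W.a₄ * x) := by linear_combination -heq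
      have e2 : W.a₄ = (y₁ ^ 2 - y ^ 2 - (x₁ ^ 3 - x ^ 3) - W.a₂ * (x₁ ^ 2 - x ^ 2)) / (x₁ - x) := by
        field_simp; linear_combination heq - heq₁
      constructor
      · rw [e1, e2]; field_simp; ring
      · rw [e1, e2]; field_simp; ring

theorem HB.triple {F K : Type*} [Field F] [Field K] [Algebra F[X] K] [IsFractionRing F[X] K]
    (p1 p2 p3 r1 r2 r3 : F[X]) (k : K) (hk : k ≠ 0)
    (h1 : k * algebraMap F[X] K p1 = algebraMap F[X] K r1)
    (h2 : k * algebraMap F[X] K p2 = algebraMap F[X] K r2)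
    (h3 : k * algebraMap F[X] K p3 = algebraMap F[X] K r3)
    (hp : ∀ π : F[X], Prime π → π ∣ p1 → π ∣ p2 → π ∣ p3 → False)
    (hr : ∀ π : F[X], Prime π → π ∣ r1 → π ∣ r2 → π ∣ r3 → False) :
    r1.degree = p1.degree ∧ r2.degree = p2.degree ∧ r3.degree = p3.degree := by
  obtain ⟨s, t, hst, hkk⟩ := IsFractionRing.exists_reduced_fraction (A := F[X]) k
  have ht0 : (t : F[X]) ≠ 0 := nonZeroDivisors.coe_ne_zero t
  have hinj := IsFractionRing.injective F[X] K
  have htK : algebraMap F[X] K (t : F[X]) ≠ 0 := by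
    simp
  rw [IsFractionRing.mk'_eq_div] at hkk
  have key : ∀ p r : F[X], k * algebraMap F[X] K p = algebraMap F[X] K r → s * p = t * r := by
    intro p r h
    apply hinj
    rw [map_mul, map_mul, ← h, ← hkk]
    field_simp
  have hs0 : s ≠ 0 := by
    rintro rfl
    apply hk; rw [← hkk]; simp
  have e1 := key _ _ h1
  have e2 := key _ _ h2
  have e3 := key _ _ h3
  have hcop : IsCoprime s (t : F[X]) := hst.isCoprime
  have htu : IsUnit (t : F[X]) := by
    by_contra hn
    obtain ⟨π, hπ, hd⟩ := WfDvdMonoid.exists_irreducible_factor hn ht0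
    have hc : IsCoprime π s := (hcop.of_isCoprime_of_dvd_right hd).symm
    refine hp π hπ.prime ?_ ?_ ?_
    · exact hc.dvd_of_dvd_mul_left (e1 ▸ Dvd.dvd.mul_right hd _)
    · exact hc.dvd_of_dvd_mul_left (e2 ▸ Dvd.dvd.mul_right hd _)
    · exact hc.dvd_of_dvd_mul_left (e3 ▸ Dvd.dvd.mul_right hd _)
  have hsu : IsUnit s := by
    by_contra hn
    obtain ⟨π, hπ, hd⟩ := WfDvdMonoid.exists_irreducible_factor hn hs0
    have hc : IsCoprime π (t : F[X]) := hcop.of_isCoprime_of_dvd_left hd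
    refine hr π hπ.prime ?_ ?_ ?_
    · exact hc.dvd_of_dvd_mul_left (e1 ▸ Dvd.dvd.mul_right hd _)
    · exact hc.dvd_of_dvd_mul_left (e2 ▸ Dvd.dvd.mul_right hd _)
    · exact hc.dvd_of_dvd_mul_left (e3 ▸ Dvd.dvd.mul_right hd _)
  have hd : ∀ p r : F[X], s * p = t * r → r.degree = p.degree := by
    intro p r h
    have := congrArg Polynomial.degree h
    rw [degree_mul, degree_mul, degree_eq_zero_of_isUnit htu, degree_eq_zero_of_isUnit hsu] at this
    simpa using this.symm
  exact ⟨hd _ _ e1, hd _ _ e2, hd _ _ e3⟩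

/-- The monic cubic. -/
noncomputable def HB.cub {F : Type*} [Field F] (a b c : F) : F[X] :=
  X ^ 3 + C a * X ^ 2 + C b * X + C c

theorem HB.step {F K : Type*} [Field F] [Field K] [Algebra F[X] K] [IsFractionRing F[X] K]
    (a b c : F) (h2 : (2 : F) ≠ 0) (hsep : (HB.cub a b c).Separable)
    (f g f₁ g₁ f₂ g₂ : F[X]) (h : IsCoprime f g) (h₁ : IsCoprime f₁ g₁) (h₂ : IsCoprime f₂ g₂)
    (hd : g.degree < f.degree) (k : K) (hk : k ≠ 0)
    (e1 : k * algebraMap F[X] K (g₁ * g₂) = algebraMap F[X] K ((f - X * g) ^ 2))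
    (e2 : k * algebraMap F[X] K (f₁ * g₂ + g₁ * f₂) = algebraMap F[X] K
      (2 * ((f + X * g) * (f * X + C b * g) + 2 * C a * f * g * X + 2 * C c * g ^ 2)))
    (e3 : k * algebraMap F[X] K (f₁ * f₂) = algebraMap F[X] K
      ((f * X - C b * g) ^ 2 - 4 * C c * g * (f + X * g + C a * g))) :
    g₁.degree < f₁.degree ∧ g₂.degree < f₂.degree ∧
      f₁.natDegree + f₂.natDegree = 2 * f.natDegree + 2 ∧
      (g₁ * g₂).degree = ((f - X * g) ^ 2).degree := by
  have h2' : IsUnit (2 : F[X]) := by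
    rw [show (2 : F[X]) = C 2 from rfl]
    exact isUnit_C.2 (isUnit_iff_ne_zero.2 h2)
  have hder : derivative (HB.cub a b c) = 3 * X ^ 2 + 2 * C a * X + C b := by
    simp only [HB.cub, derivative_add, derivative_mul, derivative_C, derivative_X_pow, derivative_X,
      Nat.cast_ofNat, map_ofNat]
    ring
  have hnot : ∀ π : F[X], Prime π → ∀ {u v : F[X]}, IsCoprime u v → π ∣ u → π ∣ v → False := by
    intro π hπ u v hc hu hv
    exact hπ.not_isUnit (hc.isUnit_of_dvd' hu hv)
  obtain ⟨d1, d2, d3⟩ := HB.triple _ _ _ _ _ _ k hk e1 e2 e3 (by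
    intro π hπ q1 q2 q3
    rcases hπ.dvd_or_dvd q1 with q | q
    · rcases hπ.dvd_or_dvd q3 with q' | q'
      · exact hnot π hπ h₁ q' q
      · have : π ∣ f₁ * g₂ := (dvd_add_left (q.mul_right _)).1 q2
        rcases hπ.dvd_or_dvd this with r | r
        · exact hnot π hπ h₁ r q
        · exact hnot π hπ h₂ q' r
    · rcases hπ.dvd_or_dvd q3 with q' | q'
      · have : π ∣ g₁ * f₂ := (dvd_add_right (q.mul_left _)).1 q2
        rcases hπ.dvd_or_dvd this with r | r
        · exact hnot π hπ h₁ q' r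
        · exact hnot π hπ h₂ r q
      · exact hnot π hπ h₂ q' q) (by
    intro π hπ q1 q2 q3
    have q := hπ.dvd_of_dvd_pow q1
    have hg : ¬ π ∣ g := by
      intro hg
      have : π ∣ f := by
        have := dvd_add q (hg.mul_left X)
        simpa using this
      exact hnot π hπ h this hg
    have hf : π ∣ HB.cub a b c := by
      have q2' := (h2'.dvd_mul_left).1 q2
      have : π ∣ 2 * (g ^ 2 * HB.cub a b c) := by
        obtain ⟨w, hw⟩ := q
        obtain ⟨z, hz⟩ := q2'
        have hfw : f = X * g + π * w := by linear_combination hw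
        rw [hfw] at hz
        refine ⟨z - (w * ((X * g + π * w) * X + C b * g) + 2 * X * g * X * w + 2 * C a * w * g * X), ?_⟩
        rw [mul_sub, ← hz]
        simp only [HB.cub]
        ring
      have := (h2'.dvd_mul_left).1 this
      rcases hπ.dvd_or_dvd this with r | r
      · exact absurd (hπ.dvd_of_dvd_pow r) hg
      · exact r
    have hf' : π ∣ derivative (HB.cub a b c) := by
      have : π ∣ g ^ 2 * derivative (HB.cub a b c) ^ 2 := by
        rw [hder]
        obtain ⟨w, hw⟩ := q
        obtain ⟨z, hz⟩ := q3
        obtain ⟨y, hy⟩ := hf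
        have hfw : f = X * g + π * w := by linear_combination hw
        rw [hfw] at hz
        refine ⟨z - w * X * (2 * (X * g * X - C b * g) + π * w * X) + 4 * C c * g * w + (8 * X + 4 * C a) * g ^ 2 * y, ?_⟩
        rw [HB.cub] at hy
        linear_combination hz + (8 * X + 4 * C a) * g ^ 2 * hy
      rcases hπ.dvd_or_dvd this with r | r
      · exact absurd (hπ.dvd_of_dvd_pow r) hg
      · exact hπ.dvd_of_dvd_pow r
    exact hnot π hπ hsep hf hf')
  have hf0 : f ≠ 0 := by rintro rfl; simp at hd
  set d := f.natDegree with hdd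
  have hfd : f.degree = d := degree_eq_natDegree hf0
  have hfn : f.natDegree ≤ d := le_rfl
  have hgn : g.natDegree ≤ d := natDegree_le_natDegree hd.le
  have hXgn : (X * g).natDegree ≤ d := by
    by_cases hg0 : g = 0
    · simp [hg0]
    · rw [natDegree_X_mul hg0]
      exact natDegree_lt_natDegree hg0 hd
  have hC : ∀ r : F, (C r).natDegree ≤ 0 := fun r => (natDegree_C r).le
  have h20 : (2 : F[X]).natDegree ≤ 0 := (natDegree_C (2 : F)).le
  have h40 : (4 : F[X]).natDegree ≤ 0 := (natDegree_C (4 : F)).le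
  have hX1 : (X : F[X]).natDegree ≤ 1 := natDegree_X_le
  have hm : ∀ {p q : F[X]} {m n N : ℕ}, p.natDegree ≤ m → q.natDegree ≤ n → m + n ≤ N →
      (p * q).natDegree ≤ N := fun hp hq hN => (natDegree_mul_le_of_le hp hq).trans hN
  have ha : ∀ {p q : F[X]} {N : ℕ}, p.natDegree ≤ N → q.natDegree ≤ N →
      (p + q).natDegree ≤ N := fun hp hq => natDegree_add_le_of_degree_le hp hq
  have dB : ((f - X * g) ^ 2).degree ≤ ((2 * d : ℕ) : WithBot ℕ) := by
    apply degree_le_of_natDegree_le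
    refine natDegree_pow_le_of_le 2 ((natDegree_sub_le_of_le hfn hXgn).trans (by simp))
  have dC : (2 * ((f + X * g) * (f * X + C b * g) + 2 * C a * f * g * X + 2 * C c * g ^ 2)).degree
      ≤ ((2 * d + 1 : ℕ) : WithBot ℕ) := by
    apply degree_le_of_natDegree_le
    refine hm h20 (n := 2 * d + 1) (ha (ha (hm (ha hfn hXgn) (n := d + 1) (ha (hm hfn hX1 le_rfl)
      (hm (hC b) hgn (by omega))) (by omega)) ?_) ?_) (by omega)
    · exact hm (hm (hm (hm h20 (hC a) le_rfl) hfn le_rfl) hgn le_rfl) hX1 (by omega)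
    · exact hm (hm h20 (hC c) le_rfl) (natDegree_pow_le_of_le 2 hgn) (by omega)
  have dA : ((f * X - C b * g) ^ 2 - 4 * C c * g * (f + X * g + C a * g)).degree =
      ((2 * d + 2 : ℕ) : WithBot ℕ) := by
    have e : (f * X - C b * g) ^ 2 - 4 * C c * g * (f + X * g + C a * g) =
      (f * X) ^ 2 + (C (-(2 * b)) * f * (X * g) + C (b ^ 2) * g ^ 2
        + C (-(4 * c)) * g * (f + X * g + C a * g)) := by
      simp only [map_neg, map_mul, map_pow, map_ofNat]; ring
    have e1 : ((f * X) ^ 2).degree = ((2 * d + 2 : ℕ) : WithBot ℕ) := by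
      rw [degree_pow, degree_mul, degree_X, hfd]
      norm_cast
    rw [e, degree_add_eq_left_of_degree_lt, e1]
    rw [e1]
    refine lt_of_le_of_lt (b := ((2 * d + 1 : ℕ) : WithBot ℕ)) ?_ (by exact_mod_cast Nat.lt_succ_self _)
    apply degree_le_of_natDegree_le
    refine ha (ha ?_ ?_) ?_
    · exact hm (hm (hC _) hfn le_rfl) hXgn (by omega)
    · exact hm (hC _) (natDegree_pow_le_of_le 2 hgn) (by omega)
    · exact hm (hm (hC _) hgn le_rfl) (ha (ha hfn hXgn) (hm (hC a) hgn (by omega))) (by omega)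
  rw [d1] at dB
  rw [d2] at dC
  rw [d3] at dA
  have aux : ∀ f₁ g₁ f₂ g₂ : F[X], (g₁ * g₂).degree ≤ ((2 * d : ℕ) : WithBot ℕ) →
      (f₁ * g₂ + g₁ * f₂).degree ≤ ((2 * d + 1 : ℕ) : WithBot ℕ) →
      (f₁ * f₂).degree = ((2 * d + 2 : ℕ) : WithBot ℕ) → g₁.degree < f₁.degree := by
    intro f₁ g₁ f₂ g₂ dB dC dA
    by_contra hcon
    push Not at hcon
    have i1 : (f₁ * g₂).degree ≤ ((2 * d : ℕ) : WithBot ℕ) := by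
      refine le_trans ?_ dB
      rw [degree_mul, degree_mul]; gcongr
    have i2 : ((2 * d + 2 : ℕ) : WithBot ℕ) ≤ (g₁ * f₂).degree := by
      rw [← dA, degree_mul, degree_mul]; gcongr
    have i3 : (f₁ * g₂).degree < (g₁ * f₂).degree := by
      refine lt_of_le_of_lt i1 (lt_of_lt_of_le ?_ i2)
      exact_mod_cast (by omega : 2 * d < 2 * d + 2)
    rw [degree_add_eq_right_of_degree_lt i3] at dC
    have := i2.trans dC
    have : 2 * d + 2 ≤ 2 * d + 1 := by exact_mod_cast this
    omega
  have hff : f₁ ≠ 0 ∧ f₂ ≠ 0 := by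
    rw [← mul_ne_zero_iff]
    intro h0
    have := natDegree_eq_of_degree_eq_some dA
    rw [h0] at this
    simp at this
  refine ⟨aux f₁ g₁ f₂ g₂ dB dC dA, aux f₂ g₂ f₁ g₁ ?_ ?_ ?_, ?_, d1.symm⟩
  · rwa [mul_comm]
  · rwa [mul_comm f₂, mul_comm g₂, add_comm]
  · rwa [mul_comm]
  · rw [← natDegree_mul hff.1 hff.2]
    exact natDegree_eq_of_degree_eq_some dA

/-- The quadratic twist of the cubic `y² = x³ + a x² + b x + c` by itself, over `F(x)`. -/
noncomputable def HB.W {F : Type*} (K : Type*) [Field F] [Field K] [Algebra F[X] K] (a b c : F) :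
    WeierstrassCurve.Affine K :=
  { a₁ := 0
    a₂ := algebraMap F[X] K (C a * HB.cub a b c)
    a₃ := 0
    a₄ := algebraMap F[X] K (C b * HB.cub a b c ^ 2)
    a₆ := algebraMap F[X] K (C c * HB.cub a b c ^ 3) }

/-- `f / g` in lowest terms is the (untwisted) `x`-coordinate of `P`. -/
def HB.Rep {F K : Type*} [Field F] [Field K] [Algebra F[X] K] (L : F[X])
    {W : WeierstrassCurve.Affine K} (P : W.Point) (f g : F[X]) : Prop :=
  IsCoprime f g ∧ ∃ s : K, s ≠ 0 ∧ algebraMap F[X] K L * algebraMap F[X] K f = s * P.xRep 0 ∧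
    algebraMap F[X] K g = s * P.xRep 1

theorem HB.Rep.exists {F K : Type*} [Field F] [Field K] [Algebra F[X] K] [IsFractionRing F[X] K]
    (L : F[X]) (hL : L ≠ 0) {W : WeierstrassCurve.Affine K} (P : W.Point) :
    ∃ f g, HB.Rep L P f g := by
  have hL' : algebraMap F[X] K L ≠ 0 := by simpa using hL
  rcases P with _ | ⟨x, y, h⟩
  · rw [← WeierstrassCurve.Affine.Point.zero_def]
    exact ⟨1, 0, isCoprime_one_left, algebraMap F[X] K L, hL', by simp, by simp⟩
  · obtain ⟨s, t, hst, hkk⟩ := IsFractionRing.exists_reduced_fraction (A := F[X])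
      (x / algebraMap F[X] K L)
    have htK : algebraMap F[X] K (t : F[X]) ≠ 0 := by simp
    rw [IsFractionRing.mk'_eq_div] at hkk
    refine ⟨s, t, hst.isCoprime, algebraMap F[X] K (t : F[X]), htK, ?_, ?_⟩
    · simp
      field_simp at hkk
      linear_combination hkk
    · simp

theorem HB.Rep.unique {F K : Type*} [Field F] [Field K] [Algebra F[X] K] [IsFractionRing F[X] K]
    (L : F[X]) (hL : L ≠ 0) {W : WeierstrassCurve.Affine K} (P : W.Point) (f g f' g' : F[X])
    (h : HB.Rep L P f g) (h' : HB.Rep L P f' g') :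
    f.degree = f'.degree ∧ g.degree = g'.degree := by
  obtain ⟨hc, s, hs, e1, e2⟩ := h
  obtain ⟨hc', s', hs', e1', e2'⟩ := h'
  have key : f * g' = f' * g := by
    apply mul_left_cancel₀ hL
    apply IsFractionRing.injective F[X] K
    simp only [map_mul]
    rw [← mul_assoc, ← mul_assoc, e1, e1', e2, e2']
    ring
  constructor
  · apply degree_eq_degree_of_associated
    apply associated_of_dvd_dvd
    · exact hc.dvd_of_dvd_mul_right (key ▸ Dvd.intro _ rfl)
    · exact hc'.dvd_of_dvd_mul_right (key ▸ Dvd.intro _ rfl)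
  · apply degree_eq_degree_of_associated
    apply associated_of_dvd_dvd
    · exact hc.symm.dvd_of_dvd_mul_left (key ▸ Dvd.intro_left _ rfl)
    · exact hc'.symm.dvd_of_dvd_mul_left (key ▸ Dvd.intro_left _ rfl)

theorem HB.cub_ne {F : Type*} [Field F] (a b c : F) : HB.cub a b c ≠ 0 := by
  intro h
  have : (HB.cub a b c).coeff 3 = 1 := by
    simp [HB.cub]
  rw [h] at this
  simp at this

theorem HB.Q_ns {F K : Type*} [Field F] [Field K] [Algebra F[X] K] [IsFractionRing F[X] K]
    (h2 : (2 : K) ≠ 0) (a b c : F) (X' Y' : F[X]) (hY : Y' ≠ 0)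
    (h : HB.cub a b c * Y' ^ 2 = X' ^ 3 + C a * X' ^ 2 + C b * X' + C c) :
    (HB.W K a b c).Nonsingular (algebraMap F[X] K (HB.cub a b c * X'))
      (algebraMap F[X] K (HB.cub a b c ^ 2 * Y')) := by
  rw [WeierstrassCurve.Affine.nonsingular_iff, WeierstrassCurve.Affine.equation_iff]
  constructor
  · simp only [HB.W, zero_mul, add_zero]
    simp only [← map_mul, ← map_pow, ← map_add]
    congr 1
    linear_combination (HB.cub a b c) ^ 3 * h
  · right
    simp only [HB.W, zero_mul, sub_zero]
    intro e
    have : (2 : K) * algebraMap F[X] K (HB.cub a b c ^ 2 * Y') = 0 := by linear_combination e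
    rcases mul_eq_zero.1 this with h | h
    · exact h2 h
    · have := (map_eq_zero_iff _ (IsFractionRing.injective F[X] K)).1 h
      exact mul_ne_zero (pow_ne_zero _ (HB.cub_ne a b c)) hY this

theorem HB.Q_eq {F : Type*} [Field F] (a b c : F) :
    HB.cub a b c * (1 : F[X]) ^ 2 = X ^ 3 + C a * X ^ 2 + C b * X + C c := by
  simp [HB.cub]

theorem HB.Rep.step {F K : Type*} [Field F] [Field K] [DecidableEq K] [Algebra F[X] K]
    [IsFractionRing F[X] K]
    (a b c : F) (h2 : (2 : F) ≠ 0) (h2K : (2 : K) ≠ 0) (hsep : (HB.cub a b c).Separable)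
    (P Q : (HB.W K a b c).Point)
    (hQ : Q = .some _ _ (HB.Q_ns h2K a b c X 1 one_ne_zero (HB.Q_eq a b c)))
    (f g f₁ g₁ f₂ g₂ : F[X]) (h : HB.Rep (HB.cub a b c) P f g)
    (h₁ : HB.Rep (HB.cub a b c) (P + Q) f₁ g₁) (h₂ : HB.Rep (HB.cub a b c) (P - Q) f₂ g₂)
    (hd : g.degree < f.degree) :
    g₁.degree < f₁.degree ∧ g₂.degree < f₂.degree ∧
      f₁.natDegree + f₂.natDegree = 2 * f.natDegree + 2 ∧
      (g₁ * g₂).degree = ((f - X * g) ^ 2).degree := by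
  obtain ⟨hc, s, hs, e1, e2⟩ := h
  obtain ⟨hc₁, s₁, hs₁, e1₁, e2₁⟩ := h₁
  obtain ⟨hc₂, s₂, hs₂, e1₂, e2₂⟩ := h₂
  have hinj := IsFractionRing.injective F[X] K
  have hL : algebraMap F[X] K (HB.cub a b c) ≠ 0 := by
    simpa using HB.cub_ne a b c
  obtain ⟨k, hk, k1, k2, k3⟩ := HB.xrel h2K (HB.W K a b c) rfl rfl P _ _
    (HB.Q_ns h2K a b c X 1 one_ne_zero (HB.Q_eq a b c)) (by
      rw [Ne, map_eq_zero_iff _ hinj]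
      simpa using HB.cub_ne a b c)
  rw [← hQ] at k1 k2 k3
  have w2 : (HB.W K a b c).a₂ = algebraMap F[X] K (C a * HB.cub a b c) := rfl
  have w4 : (HB.W K a b c).a₄ = algebraMap F[X] K (C b * HB.cub a b c ^ 2) := rfl
  have w6 : (HB.W K a b c).a₆ = algebraMap F[X] K (C c * HB.cub a b c ^ 3) := rfl
  rw [w2, w4, w6] at k3
  rw [w2, w4, w6] at k2
  simp only [map_mul, map_pow] at k1 k2 k3
  set l := algebraMap F[X] K (HB.cub a b c) with hl
  have r0 : P.xRep 0 = l * algebraMap F[X] K f / s := by rw [e1]; field_simp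
  have r1 : P.xRep 1 = algebraMap F[X] K g / s := by rw [e2]; field_simp
  have r0₁ : (P + Q).xRep 0 = l * algebraMap F[X] K f₁ / s₁ := by rw [e1₁]; field_simp
  have r1₁ : (P + Q).xRep 1 = algebraMap F[X] K g₁ / s₁ := by rw [e2₁]; field_simp
  have r0₂ : (P - Q).xRep 0 = l * algebraMap F[X] K f₂ / s₂ := by rw [e1₂]; field_simp
  have r1₂ : (P - Q).xRep 1 = algebraMap F[X] K g₂ / s₂ := by rw [e2₂]; field_simp
  rw [r0, r1, r0₁, r0₂] at k3
  rw [r0, r1, r0₁, r1₁, r0₂, r1₂] at k2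
  rw [r0, r1, r1₁, r1₂] at k1
  refine HB.step (K := K) a b c h2 hsep f g f₁ g₁ f₂ g₂ hc hc₁ hc₂ hd
    (k * s ^ 2 / (s₁ * s₂ * l ^ 2)) ?_ ?_ ?_ ?_
  · exact div_ne_zero (mul_ne_zero hk (pow_ne_zero _ hs))
      (mul_ne_zero (mul_ne_zero hs₁ hs₂) (pow_ne_zero _ hL))
  · simp only [map_mul, map_pow, map_sub, map_add, map_ofNat]
    field_simp at k1 ⊢
    linear_combination k1
  · simp only [map_mul, map_pow, map_sub, map_add, map_ofNat]
    field_simp at k2 ⊢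
    linear_combination k2
  · simp only [map_mul, map_pow, map_sub, map_add, map_ofNat]
    field_simp at k3 ⊢
    linear_combination k3

theorem HB.fact {F : Type*} [Field F] [Fintype F] [DecidableEq F]
    (hodd : Odd (Fintype.card F)) (L : F[X]) (hsep : L.Separable) :
    ∃ L0 w R Z T : F[X], L = Z * L0 ∧ L ^ (Fintype.card F / 2) + 1 = T * w ∧
      X ^ Fintype.card F - X = R * Z * T ∧ IsCoprime (L0 * w ^ 2) (R ^ 2 * Z) ∧
      R ^ 2 * Z ≠ 0 ∧
      ((R ^ 2 * Z).natDegree : ℤ) = Fintype.card F + ∑ y : F, quadraticChar F (L.eval y) := by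
  classical
  have hch : ringChar F ≠ 2 := by
    intro h
    have := FiniteField.even_card_of_char_two h
    rw [Nat.odd_iff] at hodd
    omega
  have h2 : (2 : F) ≠ 0 := Ring.two_ne_zero hch
  have hm : Fintype.card F / 2 ≠ 0 := by
    have := Fintype.one_lt_card (α := F)
    omega
  set m := Fintype.card F / 2 with hmdef
  have hpow : ∀ y : F, ((quadraticChar F y : ℤ) : F) = y ^ m := fun y =>
    quadraticChar_eq_pow_of_char_ne_two' hch y
  set P : ℤ → F[X] := fun i =>
    ∏ y ∈ Finset.univ.filter (fun y : F => quadraticChar F (L.eval y) = i), (X - C y) with hP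
  have hPmonic : ∀ i, (P i).Monic := fun i => monic_prod_of_monic _ _ fun y _ => monic_X_sub_C y
  have hdeg : ∀ i, (P i).natDegree =
      (Finset.univ.filter (fun y : F => quadraticChar F (L.eval y) = i)).card := by
    intro i
    simp only [hP]
    rw [natDegree_prod_of_monic _ _ fun y _ => monic_X_sub_C y]
    simp
  have hcop : ∀ s : Finset F, (s : Set F).Pairwise (Function.onFun IsCoprime fun y : F => X - C y) := by
    intro s x _ y _ hxy
    exact isCoprime_X_sub_C_of_isUnit_sub (sub_ne_zero.2 hxy).isUnit
  have hdvd : ∀ i (p : F[X]), (∀ y, quadraticChar F (L.eval y) = i → p.eval y = 0) → P i ∣ p := by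
    intro i p h
    apply Finset.prod_dvd_of_coprime (hcop _)
    intro y hy
    exact dvd_iff_isRoot.2 (h y (by simpa using hy))
  obtain ⟨L0, hL0⟩ : P 0 ∣ L := hdvd 0 L fun y hy => quadraticChar_eq_zero_iff.1 hy
  obtain ⟨w, hw⟩ : P (-1) ∣ L ^ m + 1 := hdvd _ _ fun y hy => by
    have := hpow (L.eval y)
    rw [hy] at this
    simp [← this]
  have hprod : X ^ Fintype.card F - X = ∏ y : F, (X - C y) := by
    have h1 := FiniteField.roots_X_pow_card_sub_X F
    have h3 : (X ^ Fintype.card F - X : F[X]).Monic :=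
      monic_X_pow_sub (by simpa using Fintype.one_lt_card (α := F))
    have h4 := prod_multiset_X_sub_C_of_monic_of_roots_card_eq h3 (by
      rw [h1, FiniteField.X_pow_card_sub_X_natDegree_eq F Fintype.one_lt_card]; rfl)
    rw [← h4, h1]; rfl
  have htri : ∀ y : F, quadraticChar F (L.eval y) = 1 ∨ quadraticChar F (L.eval y) = 0 ∨
      quadraticChar F (L.eval y) = -1 := by
    intro y
    by_cases h : L.eval y = 0
    · simp [h]
    · rcases quadraticChar_dichotomy h with h | h <;> simp [h]
  refine ⟨L0, w, P 1, P 0, P (-1), hL0, hw, ?_, ?_, ?_, ?_⟩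
  · rw [hprod]
    simp only [hP, Finset.prod_filter, ← Finset.prod_mul_distrib]
    apply Finset.prod_congr rfl
    intro y _
    rcases htri y with h | h | h <;> simp [h]
  · have key : ∀ i, (i = 0 ∨ i = 1) → IsCoprime (L0 * w ^ 2) (P i) := by
      intro i hi
      apply IsCoprime.prod_right
      intro y hy
      have hy : quadraticChar F (L.eval y) = i := by simpa using hy
      have hwy : w.eval y ≠ 0 := by
        intro h0
        have e := congrArg (eval y) hw
        simp only [eval_add, eval_pow, eval_one, eval_mul, h0, mul_zero] at e
        rw [← hpow, hy] at e
        rcases hi with rfl | rfl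
        · simp at e
        · apply h2; rw [← e]; push_cast; ring
      have hLy : L0.eval y ≠ 0 := by
        intro h0
        have e := congrArg (eval y) hL0
        simp only [eval_mul, h0, mul_zero] at e
        have hy0 : quadraticChar F (L.eval y) = 0 := by simp [e]
        have d1 : (X - C y) ∣ P 0 := Finset.dvd_prod_of_mem _ (by simp [e])
        have d2 : (X - C y) ∣ L0 := dvd_iff_isRoot.2 h0
        have := hsep.squarefree (X - C y) (by rw [hL0]; exact mul_dvd_mul d1 d2)
        exact not_isUnit_X_sub_C y this
      apply IsCoprime.symm
      rw [(irreducible_X_sub_C y).coprime_iff_not_dvd, dvd_iff_isRoot]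
      simp [hwy, hLy]
    exact (key 1 (Or.inr rfl)).pow_right.mul_right (key 0 (Or.inl rfl))
  · exact mul_ne_zero (pow_ne_zero _ (hPmonic _).ne_zero) (hPmonic _).ne_zero
  · rw [((hPmonic 1).pow 2).natDegree_mul (hPmonic 0), (hPmonic 1).natDegree_pow, hdeg, hdeg]
    rw [Finset.card_filter, Finset.card_filter]
    have : (Fintype.card F : ℤ) = ∑ y : F, 1 := by simp
    rw [this]
    push_cast
    rw [Finset.mul_sum, ← Finset.sum_add_distrib, ← Finset.sum_add_distrib]
    apply Finset.sum_congr rfl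
    intro y _
    rcases htri y with h | h | h <;> simp [h]

theorem HB.quad_disc (S q : ℤ) (hq : Odd q) (d : ℤ → ℤ) (h0 : d 0 = q) (h1 : d (-1) = q + S + 1)
    (hrec : ∀ n, d (n + 1) + d (n - 1) = 2 * d n + 2) (hnn : ∀ n, 0 ≤ d n) :
    S ^ 2 ≤ 4 * q := by
  have key : ∀ n : ℤ, d n = n ^ 2 - S * n + q ∧ d (n + 1) = (n + 1) ^ 2 - S * (n + 1) + q := by
    intro n
    induction n using Int.induction_on with
    | zero =>
      have := hrec 0
      simp only [zero_add, zero_sub] at this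
      constructor
      · rw [h0]; ring
      · simp only [zero_add]; rw [h0, h1] at this; linarith
    | succ i ih =>
      refine ⟨ih.2, ?_⟩
      have := hrec (i + 1)
      rw [add_sub_cancel_right, ih.1, ih.2] at this
      linarith
    | pred i ih =>
      have := hrec (-i)
      rw [ih.1, ih.2] at this
      rw [sub_add_cancel]
      refine ⟨by linarith, ih.1⟩
  obtain ⟨k, hk | hk⟩ := Int.even_or_odd' S
  · have := hnn k
    rw [(key k).1] at this
    subst hk
    nlinarith
  · have := hnn k
    rw [(key k).1] at this
    obtain ⟨j, hj⟩ := hq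
    subst hk
    have h3 : k * (k + 1) ≤ q := by nlinarith
    have h4 : Even (k * (k + 1)) := Int.even_mul_succ_self k
    obtain ⟨l, hl⟩ := h4
    have h5 : k * (k + 1) + 1 ≤ q := by omega
    nlinarith

set_option maxHeartbeats 1000000 in
theorem HB.cubic_sep_aux {F K : Type*} [Field F] [Fintype F] [DecidableEq F]
    [Field K] [DecidableEq K] [Algebra F[X] K] [IsFractionRing F[X] K]
    (hodd : Odd (Fintype.card F)) (a b c : F) (hsep : (HB.cub a b c).Separable) :
    (∑ y : F, quadraticChar F ((HB.cub a b c).eval y)) ^ 2 ≤ 4 * (Fintype.card F : ℤ) := by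
  have hch : ringChar F ≠ 2 := by
    intro h
    have := FiniteField.even_card_of_char_two h
    rw [Nat.odd_iff] at hodd
    omega
  have h2 : (2 : F) ≠ 0 := Ring.two_ne_zero hch
  have hq1 : 1 < Fintype.card F := Fintype.one_lt_card
  obtain ⟨L0, w, R, Z, T, hL0, hw, hX, hcop, hg0, hdeg⟩ := HB.fact hodd (HB.cub a b c) hsep
  set q := Fintype.card F with hq
  set L := HB.cub a b c with hL
  have hLne : L ≠ 0 := HB.cub_ne a b c
  have hinj := IsFractionRing.injective F[X] K
  have h2P : (2 : F[X]) ≠ 0 := by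
    intro h
    apply h2
    have := congrArg (eval 0) h
    simpa using this
  have h2K : (2 : K) ≠ 0 := by
    intro h
    apply h2P
    apply hinj
    rw [map_ofNat, map_zero]
    exact h
  have hXq : (X ^ q - X : F[X]) ≠ 0 := FiniteField.X_pow_card_sub_X_ne_zero F hq1
  have hphi : HB.cub a b c * (L ^ (q / 2)) ^ 2 =
      (X ^ q) ^ 3 + C a * (X ^ q) ^ 2 + C b * X ^ q + C c := by
    have h1 : HB.cub a b c * (L ^ (q / 2)) ^ 2 = L ^ q := by
      rw [← hL, ← pow_mul, ← pow_succ']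
      congr 1
      rw [Nat.odd_iff] at hodd
      omega
    rw [h1, ← FiniteField.expand_card]
    simp [hL, HB.cub, hq]
  let Q : (HB.W K a b c).Point :=
    .some _ _ (HB.Q_ns h2K a b c X 1 one_ne_zero (HB.Q_eq a b c))
  let φ : (HB.W K a b c).Point :=
    .some _ _ (HB.Q_ns h2K a b c (X ^ q) (L ^ (q / 2)) (pow_ne_zero _ hLne) hphi)
  have rφ : HB.Rep L φ (X ^ q) 1 := by
    refine ⟨isCoprime_one_right, 1, one_ne_zero, ?_, ?_⟩
    · simp [φ, ← hL]
    · simp [φ]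
  have rφQ : HB.Rep L (φ - Q) (L0 * w ^ 2 - (C a + X ^ q + X) * (R ^ 2 * Z)) (R ^ 2 * Z) := by
    refine ⟨?_, algebraMap F[X] K (R ^ 2 * Z), by simpa using hg0, ?_, ?_⟩
    · obtain ⟨u, v, huv⟩ := hcop
      exact ⟨u, v + u * (C a + X ^ q + X), by linear_combination huv⟩
    · have hne : algebraMap F[X] K (L * X ^ q) ≠ algebraMap F[X] K (L * X) := by
        intro h
        exact hXq (sub_eq_zero.2 (mul_left_cancel₀ hLne (hinj h)))
      have w2 : (HB.W K a b c).a₂ = algebraMap F[X] K (C a * L) := rfl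
      have hneg : ∀ x y, (HB.W K a b c).negY x y = - y := by
        intro x y
        have w1 : (HB.W K a b c).a₁ = 0 := rfl
        have w3 : (HB.W K a b c).a₃ = 0 := rfl
        simp [WeierstrassCurve.Affine.negY, w1, w3]
      have w1 : (HB.W K a b c).a₁ = 0 := rfl
      have hx : (φ - Q).xRep 0 = ((algebraMap F[X] K (L ^ 2 * L ^ (q / 2)) + algebraMap F[X] K (L ^ 2 * 1)) /
          (algebraMap F[X] K (L * X ^ q) - algebraMap F[X] K (L * X))) ^ 2
          - algebraMap F[X] K (C a * L) - algebraMap F[X] K (L * X ^ q) - algebraMap F[X] K (L * X) := by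
        simp only [φ, Q, sub_eq_add_neg, WeierstrassCurve.Affine.Point.neg_some]
        rw [WeierstrassCurve.Affine.Point.add_of_X_ne hne]
        rw [WeierstrassCurve.Affine.Point.xRep_some, WeierstrassCurve.Affine.slope_of_X_ne hne]
        simp only [WeierstrassCurve.Affine.addX, hneg, w1, w2, ← hL]
        simp
        ring
      rw [hx]
      have hnz : algebraMap F[X] K (X ^ q - X) ≠ 0 := by
        rw [Ne, map_eq_zero_iff _ hinj]; exact hXq
      have hLz : algebraMap F[X] K L ≠ 0 := by
        rw [Ne, map_eq_zero_iff _ hinj]; exact hLne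
      have e1 : (algebraMap F[X] K (L ^ 2 * L ^ (q / 2)) + algebraMap F[X] K (L ^ 2 * 1)) /
          (algebraMap F[X] K (L * X ^ q) - algebraMap F[X] K (L * X)) =
          algebraMap F[X] K (L * (T * w)) / algebraMap F[X] K (X ^ q - X) := by
        rw [← map_add, ← map_sub, ← hw,
          show L ^ 2 * L ^ (q / 2) + L ^ 2 * 1 = L * (L * (L ^ (q / 2) + 1)) by ring,
          show L * X ^ q - L * X = L * (X ^ q - X) by ring, map_mul _ L, map_mul _ L (X ^ q - X)]
        rw [mul_div_mul_left _ _ hLz]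
      rw [e1]
      have e2 : algebraMap F[X] K (R ^ 2 * Z) *
          (algebraMap F[X] K (L * (T * w)) / algebraMap F[X] K (X ^ q - X)) ^ 2 =
          algebraMap F[X] K (L * (L0 * w ^ 2)) := by
        rw [div_pow, mul_div_assoc', div_eq_iff (pow_ne_zero _ hnz)]
        simp only [← map_mul, ← map_pow]
        congr 1
        rw [hX]
        linear_combination (R ^ 2 * Z * L * T ^ 2 * w ^ 2) * hL0
      have e3 := e2
      simp only [map_sub, map_mul, map_add] at e3 ⊢
      linear_combination - e3
    · have hne : algebraMap F[X] K (L * X ^ q) ≠ algebraMap F[X] K (L * X) := by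
        intro h
        exact hXq (sub_eq_zero.2 (mul_left_cancel₀ hLne (hinj h)))
      have h1 : (φ - Q).xRep 1 = 1 := by
        simp only [φ, Q, sub_eq_add_neg, WeierstrassCurve.Affine.Point.neg_some]
        rw [WeierstrassCurve.Affine.Point.add_of_X_ne hne]
        rw [WeierstrassCurve.Affine.Point.xRep_some]
        rfl
      rw [h1, mul_one]
  choose f g hfg using fun n : ℤ => HB.Rep.exists L hLne (φ + n • Q)
  have hstep : ∀ n : ℤ, (g n).degree < (f n).degree →
      (g (n + 1)).degree < (f (n + 1)).degree ∧ (g (n - 1)).degree < (f (n - 1)).degree ∧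
      (f (n + 1)).natDegree + (f (n - 1)).natDegree = 2 * (f n).natDegree + 2 ∧
      (g (n + 1) * g (n - 1)).degree = ((f n - X * g n) ^ 2).degree := by
    intro n hn
    refine HB.Rep.step a b c h2 h2K hsep (φ + n • Q) Q rfl (f n) (g n) _ _ _ _ (hfg n) ?_ ?_ hn
    · have := hfg (n + 1)
      rwa [add_smul, one_smul, ← add_assoc] at this
    · have := hfg (n - 1)
      rwa [sub_smul, one_smul, ← add_sub_assoc] at this
  have h00 : φ + (0 : ℤ) • Q = φ := by simp
  have hz := hfg 0
  rw [h00] at hz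
  have hu0 := HB.Rep.unique L hLne φ _ _ _ _ hz rφ
  have hgood : ∀ n : ℤ, (g n).degree < (f n).degree := by
    intro n
    induction n using Int.induction_on with
    | zero =>
      rw [hu0.1, hu0.2, degree_one, degree_X_pow]
      exact_mod_cast (by omega : 0 < q)
    | succ i ih => exact (hstep _ ih).1
    | pred i ih => exact (hstep _ ih).2.1
  have hm1 : φ + (-1 : ℤ) • Q = φ - Q := by simp [sub_eq_add_neg]
  have hz1 := hfg (-1)
  rw [hm1] at hz1
  have hu1 := HB.Rep.unique L hLne _ _ _ _ _ hz1 rφQ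
  have hd0 : (f 0).natDegree = q := by
    rw [natDegree_eq_of_degree_eq hu0.1, natDegree_X_pow]
  have hgm : ((g (-1)).natDegree : ℤ) = q + ∑ y : F, quadraticChar F (L.eval y) := by
    rw [natDegree_eq_of_degree_eq hu1.2, hdeg]
  obtain ⟨-, -, s3, s4⟩ := hstep 0 (hgood 0)
  simp only [zero_add, zero_sub] at s3 s4
  have hg0' : (g 0).natDegree = 0 := by rw [natDegree_eq_of_degree_eq hu0.2, natDegree_one]
  have hdd : (f 0 - X * g 0).natDegree = q := by
    rw [natDegree_sub_eq_left_of_natDegree_lt, hd0]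
    rw [hd0]
    calc _ ≤ natDegree (X : F[X]) + (g 0).natDegree := natDegree_mul_le
      _ < q := by rw [hg0', natDegree_X]; omega
  have hne0 : f 0 - X * g 0 ≠ 0 := by
    intro h; rw [h] at hdd; simp at hdd; omega
  have hgg : g 1 * g (-1) ≠ 0 := by
    intro h
    rw [h, degree_zero] at s4
    exact pow_ne_zero 2 hne0 (degree_eq_bot.1 s4.symm)
  have s5 := natDegree_eq_of_degree_eq s4
  rw [natDegree_pow, hdd, natDegree_mul (left_ne_zero_of_mul hgg) (right_ne_zero_of_mul hgg)] at s5
  have l1 := natDegree_lt_natDegree (left_ne_zero_of_mul hgg) (hgood 1)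
  have l2 := natDegree_lt_natDegree (right_ne_zero_of_mul hgg) (hgood (-1))
  refine HB.quad_disc _ q (by exact_mod_cast hodd) (fun n => ((f n).natDegree : ℤ)) ?_ ?_ ?_ ?_
  · simp [hd0]
  · have : (f (-1)).natDegree = (g (-1)).natDegree + 1 := by omega
    simp only [this]
    push_cast
    rw [hgm]
  · intro n
    have := (hstep n (hgood n)).2.2.1
    exact_mod_cast this
  · intro n
    positivity

theorem HB.cubic_sep {F : Type*} [Field F] [Fintype F] [DecidableEq F]
    (hodd : Odd (Fintype.card F)) (a b c : F) (hsep : (HB.cub a b c).Separable) :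
    (∑ y : F, quadraticChar F ((HB.cub a b c).eval y)) ^ 2 ≤ 4 * (Fintype.card F : ℤ) := by
  classical
  exact HB.cubic_sep_aux (K := FractionRing F[X]) hodd a b c hsep

theorem HB.char_ne_two {F : Type*} [Field F] [Fintype F] (hodd : Odd (Fintype.card F)) :
    ringChar F ≠ 2 := by
  intro h
  have := FiniteField.even_card_of_char_two h
  rw [Nat.odd_iff] at hodd
  omega

theorem HB.sq_le_one {F : Type*} [Field F] [Fintype F] [DecidableEq F] (a : F) :
    (quadraticChar F a) ^ 2 ≤ 1 := by
  by_cases h : a = 0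
  · simp [h]
  · rw [quadraticChar_sq_one h]

theorem HB.cubic_sing {F : Type*} [Field F] [Fintype F] [DecidableEq F]
    (hodd : Odd (Fintype.card F)) (a b c : F) (hsep : ¬ (HB.cub a b c).Separable) :
    (∑ y : F, quadraticChar F ((HB.cub a b c).eval y)) ^ 2 ≤ 4 * (Fintype.card F : ℤ) := by
  have hch := HB.char_ne_two hodd
  have hnd : (HB.cub a b c).natDegree = 3 := by
    unfold HB.cub; compute_degree!
  have hmon : (HB.cub a b c).Monic := by
    unfold HB.cub; monicity!
  rw [PerfectField.separable_iff_squarefree, Squarefree] at hsep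
  push Not at hsep
  obtain ⟨z, ⟨k, hk⟩, hz⟩ := hsep
  have hne := HB.cub_ne a b c
  have hz0 : z ≠ 0 := by rintro rfl; simp [hne] at hk
  have hk0 : k ≠ 0 := by rintro rfl; simp [hne] at hk
  have hdz : z.natDegree ≠ 0 := by
    intro h
    exact hz (isUnit_iff_degree_eq_zero.2 (by rw [degree_eq_natDegree hz0, h]; rfl))
  have hsum := congrArg natDegree hk
  rw [hnd, natDegree_mul (mul_ne_zero hz0 hz0) hk0, natDegree_mul hz0 hz0] at hsum
  have hz1 : z.natDegree = 1 := by omega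
  obtain ⟨r, hr⟩ := exists_root_of_degree_eq_one
    (by rw [degree_eq_natDegree hz0, hz1]; rfl : z.degree = 1)
  obtain ⟨v, hv⟩ := dvd_iff_isRoot.2 hr
  set k' := v * v * k with hk'
  have hfac : HB.cub a b c = (X - C r) ^ 2 * k' := by
    rw [hk, hv, hk']; ring
  have hmon' : k'.Monic := by
    have h1 : ((X - C r) ^ 2 : F[X]).Monic := (monic_X_sub_C r).pow 2
    rw [hfac] at hmon
    exact h1.of_mul_monic_left hmon
  have hk1 : k'.natDegree = 1 := by
    have e := congrArg natDegree hfac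
    rw [hnd, ((monic_X_sub_C r).pow 2).natDegree_mul hmon', (monic_X_sub_C r).natDegree_pow,
      natDegree_X_sub_C] at e
    omega
  have hk2 := hmon'.eq_X_add_C hk1
  set t := k'.coeff 0
  have hval : ∀ y : F, quadraticChar F ((HB.cub a b c).eval y) =
      quadraticChar F (y + t) - if y = r then quadraticChar F (r + t) else 0 := by
    intro y
    rw [hfac, hk2]
    simp only [eval_mul, eval_pow, eval_sub, eval_X, eval_C, eval_add]
    split_ifs with h
    · subst h; simp
    · rw [map_mul, quadraticChar_sq_one' (sub_ne_zero.2 h)]; simp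
  have hS : ∑ y : F, quadraticChar F ((HB.cub a b c).eval y) = - quadraticChar F (r + t) := by
    have ht : ∑ y : F, quadraticChar F (y + t) = ∑ y : F, quadraticChar F y :=
      Equiv.sum_comp (Equiv.addRight t) (fun y => quadraticChar F y)
    simp only [hval]
    rw [Finset.sum_sub_distrib, Finset.sum_ite_eq' Finset.univ r, ht, quadraticChar_sum_zero hch]
    simp
  rw [hS, neg_sq]
  have := HB.sq_le_one (r + t)
  have h1 : (1 : ℤ) < Fintype.card F := by exact_mod_cast Fintype.one_lt_card (α := F)
  linarith

theorem HB.cubic {F : Type*} [Field F] [Fintype F] [DecidableEq F]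
    (hodd : Odd (Fintype.card F)) (a b c d : F) (ha : a ≠ 0) :
    (∑ y : F, quadraticChar F (a * y ^ 3 + b * y ^ 2 + c * y + d)) ^ 2
      ≤ 4 * (Fintype.card F : ℤ) := by
  have h : (∑ y : F, quadraticChar F ((HB.cub (b / a) (c / a) (d / a)).eval y)) ^ 2
      ≤ 4 * (Fintype.card F : ℤ) := by
    by_cases hs : (HB.cub (b / a) (c / a) (d / a)).Separable
    · exact HB.cubic_sep hodd _ _ _ hs
    · exact HB.cubic_sing hodd _ _ _ hs
  have e : ∑ y : F, quadraticChar F (a * y ^ 3 + b * y ^ 2 + c * y + d) =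
      quadraticChar F a * ∑ y : F, quadraticChar F ((HB.cub (b / a) (c / a) (d / a)).eval y) := by
    rw [Finset.mul_sum]
    apply Finset.sum_congr rfl
    intro y _
    rw [← map_mul]
    congr 1
    simp [HB.cub]
    field_simp
  rw [e, mul_pow, quadraticChar_sq_one ha, one_mul]
  exact h

theorem HB.card_sq {F : Type*} [Field F] [Fintype F] [DecidableEq F]
    (hch : ringChar F ≠ 2) (A B D : F) (hA : A ≠ 0) :
    ∑ x : F, (if (A * x + B) ^ 2 = D then (1 : ℤ) else 0) = quadraticChar F D + 1 := by
  rw [← quadraticChar_card_sqrts hch D]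
  have h : ∑ x : F, (if (A * x + B) ^ 2 = D then (1 : ℤ) else 0) =
      ∑ x : F, (if x ^ 2 = D then (1 : ℤ) else 0) :=
    Equiv.sum_comp ((Equiv.mulLeft₀ A hA).trans (Equiv.addRight B))
      (fun x : F => if x ^ 2 = D then (1 : ℤ) else 0)
  rw [h]
  simp [Finset.sum_ite]

theorem HB.quartic_sum {F : Type*} [Field F] [Fintype F] [DecidableEq F]
    (hodd : Odd (Fintype.card F)) (b c d : F) (hn : ¬ (c = 0 ∧ 4 * d = b ^ 2)) :
    1 + ∑ x : F, quadraticChar F (x ^ 4 + b * x ^ 2 + c * x + d) =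
      ∑ u : F, quadraticChar F (8 * u ^ 3 + 4 * b * u ^ 2 + (-8 * d) * u + (c ^ 2 - 4 * b * d)) := by
  have hch := HB.char_ne_two hodd
  have h2 : (2 : F) ≠ 0 := Ring.two_ne_zero hch
  have h1 : ∀ x : F, ∑ u : F, (if (2 * u + b) * x ^ 2 + c * x + d - u ^ 2 = 0 then (1 : ℤ) else 0) =
      quadraticChar F (x ^ 4 + b * x ^ 2 + c * x + d) + 1 := by
    intro x
    rw [← HB.card_sq hch 1 (-x ^ 2) _ one_ne_zero]
    apply Finset.sum_congr rfl
    intro u _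
    congr 1
    apply propext
    constructor <;> intro h <;> linear_combination -h
  have h3 : ∀ u : F, ∑ x : F, (if (2 * u + b) * x ^ 2 + c * x + d - u ^ 2 = 0 then (1 : ℤ) else 0) =
      quadraticChar F (8 * u ^ 3 + 4 * b * u ^ 2 + (-8 * d) * u + (c ^ 2 - 4 * b * d)) + 1
        - if u = - b / 2 then 1 else 0 := by
    intro u
    by_cases hu : u = -b / 2
    · rw [if_pos hu]
      have hu' : 2 * u + b = 0 := by rw [hu]; field_simp; ring
      have hD : 8 * u ^ 3 + 4 * b * u ^ 2 + (-8 * d) * u + (c ^ 2 - 4 * b * d) = c ^ 2 := by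
        linear_combination (4 * u ^ 2 - 4 * d) * hu'
      rw [hD, hu']
      by_cases hc : c = 0
      · subst hc
        have : d - u ^ 2 ≠ 0 := by
          intro h
          apply hn
          refine ⟨rfl, ?_⟩
          linear_combination 4 * h + (2 * u - b) * hu'
        simp [this]
      · rw [quadraticChar_sq_one' hc]
        have : ∀ x : F, (0 * x ^ 2 + c * x + d - u ^ 2 = 0) ↔ x = (u ^ 2 - d) / c := by
          intro x
          rw [eq_div_iff hc]
          constructor <;> intro h <;> linear_combination h
        simp only [this]
        simp
    · rw [if_neg hu, sub_zero]
      have hu' : 2 * u + b ≠ 0 := by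
        intro h
        apply hu
        rw [eq_div_iff h2]
        linear_combination h
      rw [← HB.card_sq hch (2 * (2 * u + b)) c _ (mul_ne_zero h2 hu')]
      apply Finset.sum_congr rfl
      intro x _
      congr 1
      apply propext
      constructor
      · intro h
        linear_combination 4 * (2 * u + b) * h
      · intro h
        have h4 : (2 * 2 * (2 * u + b)) ≠ 0 := mul_ne_zero (mul_ne_zero h2 h2) hu'
        apply mul_left_cancel₀ h4
        linear_combination h
  have hcomm := Finset.sum_comm (s := (Finset.univ : Finset F)) (t := (Finset.univ : Finset F))
    (f := fun x u => if (2 * u + b) * x ^ 2 + c * x + d - u ^ 2 = 0 then (1 : ℤ) else 0)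
  simp only [h1, h3] at hcomm
  rw [Finset.sum_sub_distrib, Finset.sum_add_distrib, Finset.sum_add_distrib,
    Finset.sum_ite_eq' Finset.univ] at hcomm
  simp only [Finset.mem_univ, if_true] at hcomm
  linarith

theorem HB.main {F : Type*} [Field F] [Fintype F] [DecidableEq F]
    (hodd : Odd (Fintype.card F))
    (g : F[X]) (hdeg : g.natDegree = 3 ∨ g.natDegree = 4)
    (hsq : ∀ (c : F) (h : F[X]), g ≠ C c * h ^ 2) :
    (quadraticChar F (g.coeff 4) + ∑ y : F, quadraticChar F (g.eval y)) ^ 2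
      ≤ 4 * (Fintype.card F : ℤ) := by
  have hch := HB.char_ne_two hodd
  have h2 : (2 : F) ≠ 0 := Ring.two_ne_zero hch
  have h4 : (4 : F) ≠ 0 := by
    rw [show (4 : F) = 2 * 2 by norm_num]; exact mul_ne_zero h2 h2
  have h8 : (8 : F) ≠ 0 := by
    rw [show (8 : F) = 2 * 4 by norm_num]; exact mul_ne_zero h2 h4
  rcases hdeg with hdeg | hdeg
  · have h0 : g.coeff 4 = 0 := coeff_eq_zero_of_natDegree_lt (by omega)
    have h3 : g.coeff 3 ≠ 0 := by
      rw [← hdeg, coeff_natDegree, Ne, leadingCoeff_eq_zero]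
      rintro rfl; simp at hdeg
    have := HB.cubic hodd (g.coeff 3) (g.coeff 2) (g.coeff 1) (g.coeff 0) h3
    rw [h0, quadraticChar_zero, zero_add]
    convert this using 4 with y
    rw [eval_eq_sum_range, hdeg]
    simp [Finset.sum_range_succ]
    ring
  · have ha : g.coeff 4 ≠ 0 := by
      rw [← hdeg, coeff_natDegree, Ne, leadingCoeff_eq_zero]
      rintro rfl; simp at hdeg
    set a := g.coeff 4 with had
    obtain ⟨p, hp⟩ : ∃ p, g.coeff 3 = 4 * a * p :=
      ⟨g.coeff 3 / (4 * a), by field_simp⟩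
    obtain ⟨b, hb⟩ : ∃ b, g.coeff 2 = a * (b + 6 * p ^ 2) :=
      ⟨g.coeff 2 / a - 6 * p ^ 2, by field_simp; ring⟩
    obtain ⟨c, hc⟩ : ∃ c, g.coeff 1 = a * (4 * p ^ 3 + 2 * b * p + c) :=
      ⟨g.coeff 1 / a - (4 * p ^ 3 + 2 * b * p), by field_simp; ring⟩
    obtain ⟨d, hd⟩ : ∃ d, g.coeff 0 = a * (p ^ 4 + b * p ^ 2 + c * p + d) :=
      ⟨g.coeff 0 / a - (p ^ 4 + b * p ^ 2 + c * p), by field_simp; ring⟩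
    have hg : g = C a * ((X + C p) ^ 4 + C b * (X + C p) ^ 2 + C c * (X + C p) + C d) := by
      conv_lhs => rw [g.as_sum_range_C_mul_X_pow, hdeg]
      simp only [Finset.sum_range_succ, Finset.sum_range_zero, ← had, hp, hb, hc, hd]
      simp only [map_mul, map_add, map_pow, map_ofNat]
      ring
    have hn : ¬ (c = 0 ∧ 4 * d = b ^ 2) := by
      rintro ⟨rfl, h⟩
      have hd' : d = (b / 2) ^ 2 := by
        field_simp
        linear_combination h
      have hb' : b = 2 * (b / 2) := by field_simp
      apply hsq a ((X + C p) ^ 2 + C (b / 2))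
      rw [hg, hd']
      generalize b / 2 = e at hb'
      rw [hb']
      simp only [map_mul, map_pow, map_ofNat, map_zero]
      ring
    have hS : quadraticChar F a + ∑ y : F, quadraticChar F (g.eval y) =
        quadraticChar F a * (1 + ∑ x : F, quadraticChar F (x ^ 4 + b * x ^ 2 + c * x + d)) := by
      have ht := Equiv.sum_comp (Equiv.addRight p)
        (fun x => quadraticChar F (x ^ 4 + b * x ^ 2 + c * x + d))
      rw [mul_add, mul_one, ← ht, Finset.mul_sum]
      congr 1
      apply Finset.sum_congr rfl
      intro y _
      rw [← map_mul, hg]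
      congr 1
      simp
    rw [hS, mul_pow, quadraticChar_sq_one ha, one_mul, HB.quartic_sum hodd b c d hn]
    exact HB.cubic hodd _ _ _ _ h8

end

/-- (Hasse bound) For the quadratic character `χ` of a finite field of odd order
and a polynomial `g` of degree 3 or 4 which is not of the form `c · h²`, one has
`|χ(a) + ∑_y χ(g(y))| ≤ 2√q`, where `a` is the coefficient of `x⁴` in `g`. -/
theorem hasse_bound_quadratic_char_sum
    (F : Type*) [Field F] [Fintype F] [DecidableEq F]
    (hodd : Odd (Fintype.card F))
    (g : Polynomial F) (hdeg : g.natDegree = 3 ∨ g.natDegree = 4)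
    (hsq : ∀ (c : F) (h : Polynomial F), g ≠ Polynomial.C c * h ^ 2) :
    (|(quadraticChar F) (g.coeff 4) + ∑ y : F, (quadraticChar F) (g.eval y)| : ℝ)
      ≤ 2 * Real.sqrt (Fintype.card F) := by
  have h := HB.main hodd g hdeg hsq
  have h' : (((quadraticChar F) (g.coeff 4) + ∑ y : F, (quadraticChar F) (g.eval y) : ℤ) : ℝ) ^ 2
      ≤ 4 * (Fintype.card F : ℝ) := by exact_mod_cast h
  have e : 2 * Real.sqrt (Fintype.card F) = Real.sqrt (4 * (Fintype.card F : ℝ)) := by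
    rw [Real.sqrt_mul (by norm_num), show (4 : ℝ) = 2 ^ 2 by norm_num,
      Real.sqrt_sq (by norm_num)]
  rw [e]
  apply Real.abs_le_sqrt
  push_cast at h' ⊢
  exact h'
end
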